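/- arXiv:2605.13314 — 2 statements merged into one kernel-verified Lean document; each statement's English description precedes it below -/
import Mathlib

section
/- Let n > 6 and let m = n + p(n−4) + q(n−2) for some integers p ≥ 1 and q ≥ 1. Then there exists a quasiisometric embedding F : A_{C_m} → A_{C_n} (word metrics) such that F is not at finite distance from any group homomorphism A_{C_m} → A_{C_n}. -/
open scoped symmDiff

/-- The commutation relations defining the right-angled Artin group of a simple graph. -/
def raagRels {V : Type*} (Γ : SimpleGraph V) : Set (FreeGroup V) :=
  {r | ∃ v w, Γ.Adj v w ∧
    r = FreeGroup.of v * FreeGroup.of w * (FreeGroup.of v)⁻¹ * (FreeGroup.of w)⁻¹}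

/-- The right-angled Artin group of a simple graph. -/
abbrev RAAG {V : Type*} (Γ : SimpleGraph V) : Type _ :=
  PresentedGroup (raagRels Γ)

/-- The standard generating set of a right-angled Artin group. -/
def raagGen {V : Type*} (Γ : SimpleGraph V) : Set (RAAG Γ) :=
  Set.range (fun v : V => (PresentedGroup.of v : RAAG Γ))

/-- The word length of a group element with respect to a set `S`: the least length of a
word in elements of `S` and their inverses representing the element. -/
noncomputable def wordLength {G : Type*} [Group G] (S : Set G) (g : G) : ℕ :=
  sInf {k | ∃ w : List G, w.length = k ∧ (∀ x ∈ w, x ∈ S ∨ x⁻¹ ∈ S) ∧ w.prod = g}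

/-- The word metric associated with a generating set `S`. -/
noncomputable def wordDist {G : Type*} [Group G] (S : Set G) (g h : G) : ℝ :=
  (wordLength S (g⁻¹ * h) : ℝ)

/-- `f` is a quasiisometric embedding with respect to distance functions `dX`, `dY`. -/
def IsQIEWith {X Y : Type*} (dX : X → X → ℝ) (dY : Y → Y → ℝ) (f : X → Y) : Prop :=
  ∃ K A : ℝ, 1 ≤ K ∧ 0 ≤ A ∧ ∀ x x' : X,
    (1 / K) * dX x x' - A ≤ dY (f x) (f x') ∧ dY (f x) (f x') ≤ K * dX x x' + A

/-- The cycle graph on `n` vertices, with vertex set `ZMod n`. -/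
def cycleGraph (n : ℕ) : SimpleGraph (ZMod n) :=
  SimpleGraph.fromRel (fun v w => w = v + 1)

/-- Two maps into a group with the word metric of `S` are at finite distance. -/
def AtFiniteDist {Z G : Type*} [Group G] (S : Set G) (f f' : Z → G) : Prop :=
  ∃ C : ℝ, ∀ z : Z, wordDist S (f z) (f' z) ≤ C


/-! ### Words and word length in right-angled Artin groups -/

namespace RAAG

section Words

variable {V : Type*} (Γ : SimpleGraph V)

/-- The group element of a signed letter. -/
def letterVal (a : V × Bool) : RAAG Γ :=
  if a.2 then PresentedGroup.of a.1 else (PresentedGroup.of a.1)⁻¹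

/-- The group element spelled by a word, whose head is the last letter. -/
def val : List (V × Bool) → RAAG Γ
  | [] => 1
  | a :: w => val w * letterVal Γ a

/-- The inverse of a signed letter. -/
def linv (a : V × Bool) : V × Bool := (a.1, !a.2)

/-- The formal inverse of a word. -/
def invw (w : List (V × Bool)) : List (V × Bool) := (w.map linv).reverse

@[simp] lemma linv_linv (a : V × Bool) : linv (linv a) = a := by simp [linv]

@[simp] lemma linv_fst (a : V × Bool) : (linv a).1 = a.1 := rfl

lemma linv_ne (a : V × Bool) : linv a ≠ a := by
  intro h
  have := congrArg Prod.snd h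
  simp [linv] at this

@[simp] lemma invw_nil : invw ([] : List (V × Bool)) = [] := rfl

@[simp] lemma invw_cons (a : V × Bool) (w) : invw (a :: w) = invw w ++ [linv a] := by
  simp [invw]

@[simp] lemma invw_append (v w : List (V × Bool)) : invw (v ++ w) = invw w ++ invw v := by
  simp [invw]

@[simp] lemma invw_invw (w : List (V × Bool)) : invw (invw w) = w := by
  induction w with
  | nil => rfl
  | cons a w ih => simp [ih]

@[simp] lemma length_invw (w : List (V × Bool)) : (invw w).length = w.length := by
  simp [invw]

@[simp] lemma letterVal_linv (a : V × Bool) : letterVal Γ (linv a) = (letterVal Γ a)⁻¹ := by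
  rcases a with ⟨v, _ | _⟩ <;> simp [letterVal, linv]

@[simp] lemma val_nil : val Γ [] = 1 := rfl

@[simp] lemma val_cons (a : V × Bool) (w) : val Γ (a :: w) = val Γ w * letterVal Γ a := rfl

@[simp] lemma val_append (v w : List (V × Bool)) : val Γ (v ++ w) = val Γ w * val Γ v := by
  induction v with
  | nil => simp
  | cons a v ih => simp [ih, mul_assoc]

@[simp] lemma val_invw (w : List (V × Bool)) : val Γ (invw w) = (val Γ w)⁻¹ := by
  induction w with
  | nil => simp
  | cons a w ih => simp [ih]

lemma exists_val_eq (g : RAAG Γ) : ∃ w, val Γ w = g := by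
  have hg : g ∈ Subgroup.closure (Set.range (PresentedGroup.of (rels := raagRels Γ))) := by
    rw [PresentedGroup.closure_range_of]; trivial
  induction hg using Subgroup.closure_induction with
  | mem x hx =>
    obtain ⟨v, rfl⟩ := hx
    exact ⟨[(v, true)], by simp [letterVal]⟩
  | one => exact ⟨[], rfl⟩
  | mul x y _ _ hx hy =>
    obtain ⟨v, rfl⟩ := hx
    obtain ⟨w, rfl⟩ := hy
    exact ⟨w ++ v, by simp⟩
  | inv x _ hx =>
    obtain ⟨v, rfl⟩ := hx
    exact ⟨invw v, by simp⟩

lemma of_commute {v w : V} (h : Γ.Adj v w) :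
    Commute (PresentedGroup.of v : RAAG Γ) (PresentedGroup.of w) := by
  have h1 : (PresentedGroup.mk (raagRels Γ)) (FreeGroup.of v * FreeGroup.of w *
      (FreeGroup.of v)⁻¹ * (FreeGroup.of w)⁻¹) = 1 :=
    PresentedGroup.one_of_mem ⟨v, w, h, rfl⟩
  simp only [map_mul, map_inv] at h1
  change PresentedGroup.of v * PresentedGroup.of w = PresentedGroup.of w * PresentedGroup.of v
  rw [mul_inv_eq_one, mul_inv_eq_iff_eq_mul] at h1
  exact h1

lemma letterVal_commute {a b : V × Bool} (h : Γ.Adj a.1 b.1) :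
    Commute (letterVal Γ a) (letterVal Γ b) := by
  have := of_commute Γ h
  rcases a with ⟨v, _ | _⟩ <;> rcases b with ⟨w, _ | _⟩ <;> simpa [letterVal] using this

lemma exists_letterVal_of_mem {x : RAAG Γ} (hx : x ∈ raagGen Γ ∨ x⁻¹ ∈ raagGen Γ) :
    ∃ a, letterVal Γ a = x := by
  rcases hx with ⟨v, hv⟩ | ⟨v, hv⟩
  · exact ⟨(v, true), by simpa [letterVal] using hv⟩
  · refine ⟨(v, false), ?_⟩
    have : (PresentedGroup.of v : RAAG Γ) = x⁻¹ := hv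
    simp [letterVal, this]

lemma letterVal_mem (a : V × Bool) :
    letterVal Γ a ∈ raagGen Γ ∨ (letterVal Γ a)⁻¹ ∈ raagGen Γ := by
  rcases a with ⟨v, _ | _⟩
  · right; exact ⟨v, by simp [letterVal]⟩
  · left; exact ⟨v, by simp [letterVal]⟩

lemma wordLength_val_le (w : List (V × Bool)) : wordLength (raagGen Γ) (val Γ w) ≤ w.length := by
  apply Nat.sInf_le
  refine ⟨(w.map (letterVal Γ)).reverse, by simp, ?_, ?_⟩
  · intro x hx
    simp only [List.mem_reverse, List.mem_map] at hx
    obtain ⟨a, -, rfl⟩ := hx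
    exact letterVal_mem Γ a
  · induction w with
    | nil => simp
    | cons a w ih => simpa using congrArg (· * letterVal Γ a) ih

lemma exists_val_length_eq (g : RAAG Γ) :
    ∃ w, val Γ w = g ∧ w.length = wordLength (raagGen Γ) g := by
  have hne : {k | ∃ w : List (RAAG Γ), w.length = k ∧
      (∀ x ∈ w, x ∈ raagGen Γ ∨ x⁻¹ ∈ raagGen Γ) ∧ w.prod = g}.Nonempty := by
    obtain ⟨w, rfl⟩ := exists_val_eq Γ g
    refine ⟨_, (w.map (letterVal Γ)).reverse, rfl, ?_, ?_⟩
    · intro x hx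
      simp only [List.mem_reverse, List.mem_map] at hx
      obtain ⟨a, -, rfl⟩ := hx
      exact letterVal_mem Γ a
    · induction w with
      | nil => simp
      | cons a w ih => simpa using congrArg (· * letterVal Γ a) ih
  obtain ⟨l, hl, hmem, hprod⟩ := Nat.sInf_mem hne
  suffices ∀ l : List (RAAG Γ), (∀ x ∈ l, x ∈ raagGen Γ ∨ x⁻¹ ∈ raagGen Γ) →
      ∃ w, val Γ w = l.prod ∧ w.length = l.length by
    obtain ⟨w, h1, h2⟩ := this l hmem
    exact ⟨w, h1.trans hprod, h2.trans hl⟩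
  intro l
  induction l with
  | nil => intro _; exact ⟨[], by simp⟩
  | cons x l ih =>
    intro h
    obtain ⟨w, h1, h2⟩ := ih fun y hy => h y (List.mem_cons_of_mem _ hy)
    obtain ⟨a, ha⟩ := exists_letterVal_of_mem Γ (h x List.mem_cons_self)
    exact ⟨w ++ [a], by simp [h1, ha], by simp [h2]⟩

lemma wordLength_one : wordLength (raagGen Γ) (1 : RAAG Γ) = 0 := by
  simpa using wordLength_val_le Γ []

lemma wordLength_mul_le (g h : RAAG Γ) : wordLength (raagGen Γ) (g * h) ≤
    wordLength (raagGen Γ) g + wordLength (raagGen Γ) h := by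
  obtain ⟨v, rfl, hv⟩ := exists_val_length_eq Γ g
  obtain ⟨w, rfl, hw⟩ := exists_val_length_eq Γ h
  rw [← hv, ← hw, ← val_append]
  refine (wordLength_val_le Γ _).trans ?_
  simp [add_comm]

lemma wordLength_inv_le (g : RAAG Γ) :
    wordLength (raagGen Γ) g⁻¹ ≤ wordLength (raagGen Γ) g := by
  obtain ⟨v, rfl, hv⟩ := exists_val_length_eq Γ g
  rw [← hv, ← val_invw]
  simpa using wordLength_val_le Γ (invw v)

lemma wordLength_inv (g : RAAG Γ) :
    wordLength (raagGen Γ) g⁻¹ = wordLength (raagGen Γ) g :=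
  le_antisymm (wordLength_inv_le Γ g) (by simpa using wordLength_inv_le Γ g⁻¹)

lemma wordLength_letterVal_le (a : V × Bool) :
    wordLength (raagGen Γ) (letterVal Γ a) ≤ 1 := by
  simpa using wordLength_val_le Γ [a]

lemma wordLength_of_le (v : V) :
    wordLength (raagGen Γ) (PresentedGroup.of v : RAAG Γ) ≤ 1 := by
  simpa [letterVal] using wordLength_letterVal_le Γ (v, true)

/-- A subadditive function of group elements which is bounded by `C` on every signed letter
is bounded by `C` times the word length. -/
lemma le_mul_wordLength {W : Type*} {Λ : SimpleGraph W} (f : RAAG Γ → RAAG Λ) (C : ℕ)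
    (hf : ∀ g a, wordLength (raagGen Λ) ((f g)⁻¹ * f (g * letterVal Γ a)) ≤ C) (g h : RAAG Γ) :
    wordLength (raagGen Λ) ((f g)⁻¹ * f h) ≤ C * wordLength (raagGen Γ) (g⁻¹ * h) := by
  obtain ⟨w, hw, hl⟩ := exists_val_length_eq Γ (g⁻¹ * h)
  obtain rfl : h = g * val Γ w := by rw [hw]; group
  rw [← hl]
  clear hw hl
  induction w with
  | nil => simp [wordLength_one]
  | cons a w ih =>
    calc _ = wordLength (raagGen Λ) (((f g)⁻¹ * f (g * val Γ w)) *
          ((f (g * val Γ w))⁻¹ * f (g * val Γ w * letterVal Γ a))) := by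
            simp [mul_assoc]
      _ ≤ _ := wordLength_mul_le _ _ _
      _ ≤ C * w.length + C := add_le_add ih (hf _ _)
      _ = _ := by simp [mul_add]

end Words

end RAAG

/-! ### Normal forms in right-angled Artin groups -/

namespace RAAG

section Lift

variable {V : Type*} {Γ : SimpleGraph V} {G : Type*} [Group G]

/-- The homomorphism out of a right-angled Artin group determined by a map on vertices. -/
def lift (f : V → G) (hf : ∀ v w, Γ.Adj v w → Commute (f v) (f w)) : RAAG Γ →* G :=
  PresentedGroup.toGroup (f := f) (by
    rintro r ⟨v, w, h, rfl⟩
    have := (hf v w h).eq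
    simp only [map_mul, map_inv, FreeGroup.lift_apply_of]
    rw [this]
    group)

@[simp] lemma lift_of (f : V → G) (hf : ∀ v w, Γ.Adj v w → Commute (f v) (f w)) (v : V) :
    lift f hf (PresentedGroup.of v) = f v :=
  PresentedGroup.toGroup.of _

end Lift

section NormalForm

variable {V : Type*} (Γ : SimpleGraph V)

/-- `Strip Γ a w u`: the letter `a` can be shuffled to the front of `w`, leaving `u`. -/
inductive Strip (a : V × Bool) : List (V × Bool) → List (V × Bool) → Prop
  | here (w) : Strip a (a :: w) w
  | skip {b w u} : Γ.Adj a.1 b.1 → Strip a w u → Strip a (b :: w) (b :: u)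

/-- Equality of words up to shuffling of adjacent commuting letters. -/
inductive TEq : List (V × Bool) → List (V × Bool) → Prop
  | nil : TEq [] []
  | cons (a) {w w'} : TEq w w' → TEq (a :: w) (a :: w')
  | swap {a b} (w) : Γ.Adj a.1 b.1 → TEq (a :: b :: w) (b :: a :: w)
  | trans {u v w} : TEq u v → TEq v w → TEq u w

/-- A word is reduced when no letter cancels against a later one after shuffling. -/
def Red : List (V × Bool) → Prop
  | [] => True
  | a :: w => Red w ∧ ∀ u, ¬ Strip Γ (linv a) w u

variable {Γ}

@[refl] lemma TEq.refl (w : List (V × Bool)) : TEq Γ w w := by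
  induction w with
  | nil => exact .nil
  | cons a w ih => exact .cons a ih

lemma TEq.symm {w w' : List (V × Bool)} (h : TEq Γ w w') : TEq Γ w' w := by
  induction h with
  | nil => exact .nil
  | cons a _ ih => exact .cons a ih
  | swap w h => exact .swap w h.symm
  | trans _ _ h1 h2 => exact h2.trans h1

lemma TEq.length_eq {w w' : List (V × Bool)} (h : TEq Γ w w') : w.length = w'.length := by
  induction h with
  | nil => rfl
  | cons a _ ih => simp [ih]
  | swap w h => rfl
  | trans _ _ h1 h2 => exact h1.trans h2

lemma TEq.val_eq {w w' : List (V × Bool)} (h : TEq Γ w w') : val Γ w = val Γ w' := by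
  induction h with
  | nil => rfl
  | cons a _ ih => simp [ih]
  | swap w h => simp [mul_assoc, (letterVal_commute Γ h).eq]
  | trans _ _ h1 h2 => exact h1.trans h2

lemma TEq.append_left (v : List (V × Bool)) {w w' : List (V × Bool)} (h : TEq Γ w w') :
    TEq Γ (v ++ w) (v ++ w') := by
  induction v with
  | nil => exact h
  | cons a v ih => exact .cons a ih

lemma TEq.append_right (v : List (V × Bool)) {w w' : List (V × Bool)} (h : TEq Γ w w') :
    TEq Γ (w ++ v) (w' ++ v) := by
  induction h with
  | nil => exact .refl _
  | cons a _ ih => exact .cons a ih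
  | swap w h => exact .swap _ h
  | trans _ _ h1 h2 => exact h1.trans h2

lemma teq_cons_append {a : V × Bool} {w : List (V × Bool)} (h : ∀ b ∈ w, Γ.Adj a.1 b.1) :
    TEq Γ (a :: w) (w ++ [a]) := by
  induction w with
  | nil => exact .refl _
  | cons b w ih =>
    exact (TEq.swap w (h b List.mem_cons_self)).trans
      (.cons b (ih fun c hc => h c (List.mem_cons_of_mem _ hc)))

lemma Strip.teq {a : V × Bool} {w u : List (V × Bool)} (h : Strip Γ a w u) :
    TEq Γ w (a :: u) := by
  induction h with
  | here w => exact .refl _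
  | skip hab _ ih => exact (TEq.cons _ ih).trans (.swap _ hab.symm)

lemma Strip.of_teq {a : V × Bool} {w w' u : List (V × Bool)} (h : TEq Γ w w')
    (hs : Strip Γ a w u) : ∃ u', Strip Γ a w' u' ∧ TEq Γ u u' := by
  induction h generalizing u with
  | nil => cases hs
  | cons b h ih =>
    cases hs with
    | here => exact ⟨_, .here _, h⟩
    | skip hab hs =>
      obtain ⟨u', h1, h2⟩ := ih hs
      exact ⟨_, .skip hab h1, .cons _ h2⟩
  | swap w hbc =>
    cases hs with
    | here => exact ⟨_, .skip hbc (.here _), .refl _⟩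
    | skip hab hs =>
      cases hs with
      | here => exact ⟨_, .here _, .refl _⟩
      | skip hac hs => exact ⟨_, .skip hac (.skip hab hs), .swap _ hbc⟩
  | trans _ _ h1 h2 =>
    obtain ⟨u', h3, h4⟩ := h1 hs
    obtain ⟨u'', h5, h6⟩ := h2 h3
    exact ⟨u'', h5, h4.trans h6⟩

lemma Strip.unique {a : V × Bool} {w u u' : List (V × Bool)} (h : Strip Γ a w u)
    (h' : Strip Γ a w u') : u = u' := by
  induction h generalizing u' with
  | here w =>
    cases h' with
    | here => rfl
    | skip hab _ => exact (Γ.irrefl hab).elim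
  | skip hab _ ih =>
    cases h' with
    | here => exact (Γ.irrefl hab).elim
    | skip _ h => rw [ih h]

lemma strip_iff {a : V × Bool} {w u : List (V × Bool)} : Strip Γ a w u ↔
    ∃ B C, w = B ++ a :: C ∧ u = B ++ C ∧ ∀ b ∈ B, Γ.Adj a.1 b.1 := by
  constructor
  · intro h
    induction h with
    | here w => exact ⟨[], w, rfl, rfl, by simp⟩
    | @skip b w u hab _ ih =>
      obtain ⟨B, C, rfl, rfl, hB⟩ := ih
      refine ⟨b :: B, C, rfl, rfl, ?_⟩
      simpa [hab] using hB
  · rintro ⟨B, C, rfl, rfl, hB⟩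
    induction B with
    | nil => exact .here _
    | cons b B ih =>
      exact .skip (hB b List.mem_cons_self) (ih fun c hc => hB c (List.mem_cons_of_mem _ hc))

lemma Red.of_teq {w w' : List (V × Bool)} (h : TEq Γ w w') (hw : Red Γ w) : Red Γ w' := by
  induction h with
  | nil => exact hw
  | cons a h ih =>
    refine ⟨ih hw.1, fun u hu => ?_⟩
    obtain ⟨u', h1, -⟩ := hu.of_teq h.symm
    exact hw.2 _ h1
  | @swap a b w hab =>
    obtain ⟨⟨h1, h2⟩, h3⟩ := hw
    refine ⟨⟨h1, fun u hu => h3 _ (.skip hab hu)⟩, fun u hu => ?_⟩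
    have hne := hab.ne
    generalize hb : linv b = b' at hu
    cases hu with
    | here => subst hb; exact hne rfl
    | skip _ hu => subst hb; exact h2 _ hu
  | trans _ _ h1 h2 => exact h2 (h1 hw)

lemma Red.strip {a : V × Bool} {w u : List (V × Bool)} (hw : Red Γ w) (h : Strip Γ a w u) :
    Red Γ u := (hw.of_teq h.teq).1

lemma red_iff {w : List (V × Bool)} : Red Γ w ↔
    ∀ A a B C, w = A ++ a :: (B ++ linv a :: C) → ¬ ∀ b ∈ B, Γ.Adj a.1 b.1 := by
  induction w with
  | nil => simp [Red]
  | cons c w ih =>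
    simp only [Red, ih]
    constructor
    · rintro ⟨h1, h2⟩ A a B C hw hB
      cases A with
      | nil =>
        simp only [List.nil_append, List.cons.injEq] at hw
        obtain ⟨rfl, rfl⟩ := hw
        exact h2 _ (strip_iff.2 ⟨B, C, rfl, rfl, hB⟩)
      | cons c' A =>
        simp only [List.cons_append, List.cons.injEq] at hw
        exact h1 A a B C hw.2 hB
    · intro h
      refine ⟨fun A a B C hw => h (c :: A) a B C (by simp [hw]), fun u hu => ?_⟩
      obtain ⟨B, C, rfl, -, hB⟩ := strip_iff.1 hu
      exact h [] c B C rfl hB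

lemma Red.right {v w : List (V × Bool)} (h : Red Γ (v ++ w)) : Red Γ w := by
  induction v with
  | nil => exact h
  | cons a v ih => exact ih h.1

lemma Red.left {v w : List (V × Bool)} (h : Red Γ (v ++ w)) : Red Γ v := by
  rw [red_iff] at h ⊢
  rintro A a B C rfl
  exact h A a B (C ++ w) (by simp)

lemma Red.invw {w : List (V × Bool)} (h : Red Γ w) : Red Γ (invw w) := by
  rw [red_iff] at h ⊢
  intro A a B C hw hB
  have hw' := congrArg RAAG.invw hw
  simp only [invw_invw, invw_append, invw_cons, linv_linv] at hw'
  refine h (RAAG.invw C) a (RAAG.invw B) (RAAG.invw A) (by simpa using hw') ?_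
  intro b hb
  simp only [RAAG.invw, List.mem_reverse, List.mem_map] at hb
  obtain ⟨c, hc, rfl⟩ := hb
  exact hB c hc

variable (Γ) in
/-- Reduced words up to shuffling. -/
def redSetoid : Setoid {w : List (V × Bool) // Red Γ w} where
  r w w' := TEq Γ w.1 w'.1
  iseqv := ⟨fun _ => .refl _, .symm, .trans⟩

variable (Γ) in
/-- Shuffle classes of reduced words. -/
abbrev RedClass : Type _ := Quotient (redSetoid Γ)

open Classical in
/-- Multiplication of a reduced word by a letter, followed by reduction. -/
noncomputable def push (a : V × Bool) (w : List (V × Bool)) : List (V × Bool) :=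
  if h : ∃ u, Strip Γ (linv a) w u then h.choose else a :: w

lemma push_of_strip {a : V × Bool} {w u : List (V × Bool)} (h : Strip Γ (linv a) w u) :
    push (Γ := Γ) a w = u := by
  have h' : ∃ u, Strip Γ (linv a) w u := ⟨u, h⟩
  rw [push, dif_pos h']
  exact h'.choose_spec.unique h

lemma push_of_not {a : V × Bool} {w : List (V × Bool)} (h : ¬ ∃ u, Strip Γ (linv a) w u) :
    push (Γ := Γ) a w = a :: w := by
  rw [push, dif_neg h]

lemma Red.push {a : V × Bool} {w : List (V × Bool)} (hw : Red Γ w) :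
    Red Γ (push (Γ := Γ) a w) := by
  by_cases h : ∃ u, Strip Γ (linv a) w u
  · obtain ⟨u, h⟩ := h
    rw [push_of_strip h]
    exact hw.strip h
  · rw [push_of_not h]
    exact ⟨hw, fun u hu => h ⟨u, hu⟩⟩

lemma TEq.push {a : V × Bool} {w w' : List (V × Bool)} (h : TEq Γ w w') :
    TEq Γ (push (Γ := Γ) a w) (push (Γ := Γ) a w') := by
  by_cases hs : ∃ u, Strip Γ (linv a) w u
  · obtain ⟨u, hs⟩ := hs
    obtain ⟨u', h1, h2⟩ := hs.of_teq h
    rwa [push_of_strip hs, push_of_strip h1]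
  · have hs' : ¬ ∃ u, Strip Γ (linv a) w' u := by
      rintro ⟨u, hu⟩
      obtain ⟨u', h1, -⟩ := hu.of_teq h.symm
      exact hs ⟨u', h1⟩
    rw [push_of_not hs, push_of_not hs']
    exact .cons a h

lemma push_push_linv {a : V × Bool} {w : List (V × Bool)} (hw : Red Γ w) :
    TEq Γ (push (Γ := Γ) (linv a) (push (Γ := Γ) a w)) w := by
  by_cases h : ∃ u, Strip Γ (linv a) w u
  · obtain ⟨u, h⟩ := h
    have hr := hw.of_teq h.teq
    rw [push_of_strip h, push_of_not]
    · exact h.teq.symm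
    · rintro ⟨u', hu'⟩
      exact hr.2 _ hu'
  · have : Strip Γ (linv (linv a)) (a :: w) w := by
      rw [linv_linv]; exact .here _
    rw [push_of_not h, push_of_strip this]

lemma Strip.strip_of_adj {a b : V × Bool} {w u v : List (V × Bool)} (hab : Γ.Adj a.1 b.1)
    (ha : Strip Γ a w u) (hb : Strip Γ b w v) : ∃ x, Strip Γ b u x := by
  obtain ⟨v', h1, -⟩ := hb.of_teq ha.teq
  cases h1 with
  | here => exact (Γ.irrefl hab).elim
  | skip _ h => exact ⟨_, h⟩

lemma push_comm {a b : V × Bool} {w : List (V × Bool)} (hab : Γ.Adj a.1 b.1) :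
    TEq Γ (push (Γ := Γ) a (push (Γ := Γ) b w)) (push (Γ := Γ) b (push (Γ := Γ) a w)) := by
  have key : ∀ {a b : V × Bool}, Γ.Adj a.1 b.1 → (∃ u, Strip Γ (linv a) w u) →
      (¬ ∃ u, Strip Γ (linv b) w u) →
      TEq Γ (push (Γ := Γ) a (push (Γ := Γ) b w)) (push (Γ := Γ) b (push (Γ := Γ) a w)) := by
    rintro a b hab ⟨u, hu⟩ hb
    have h1 : ¬ ∃ x, Strip Γ (linv b) u x := by
      rintro ⟨x, hx⟩
      obtain ⟨y, hy, -⟩ := Strip.of_teq hu.teq.symm (.skip (a := linv b) (b := linv a) hab.symm hx)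
      exact hb ⟨y, hy⟩
    have h2 : Strip Γ (linv a) (b :: w) (b :: u) := .skip hab hu
    rw [push_of_not hb, push_of_strip h2, push_of_strip hu, push_of_not h1]
  by_cases ha : ∃ u, Strip Γ (linv a) w u <;> by_cases hb : ∃ u, Strip Γ (linv b) w u
  · obtain ⟨u, hu⟩ := ha
    obtain ⟨v, hv⟩ := hb
    have hab' : Γ.Adj (linv a).1 (linv b).1 := hab
    obtain ⟨x, hx⟩ := hu.strip_of_adj hab' hv
    obtain ⟨y, hy⟩ := hv.strip_of_adj hab'.symm hu
    rw [push_of_strip hu, push_of_strip hv, push_of_strip hx, push_of_strip hy]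
    have h1 : TEq Γ w (linv a :: linv b :: x) := hu.teq.trans (.cons _ hx.teq)
    have h2 : TEq Γ w (linv a :: linv b :: y) :=
      (hv.teq.trans (.cons _ hy.teq)).trans (.swap _ hab'.symm)
    obtain ⟨u1, h3, h4⟩ := Strip.of_teq (h2.symm.trans h1) (.here _)
    cases h3 with
    | skip h => exact (Γ.irrefl h).elim
    | here =>
      obtain ⟨u2, h5, h6⟩ := Strip.of_teq h4 (.here _)
      cases h5 with
      | skip h => exact (Γ.irrefl h).elim
      | here => exact h6
  · exact key hab ha hb
  · exact (key hab.symm hb ha).symm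
  · have h1 : ∀ {a b : V × Bool}, Γ.Adj a.1 b.1 → (¬ ∃ u, Strip Γ (linv a) w u) →
        ¬ ∃ u, Strip Γ (linv a) (b :: w) u := by
      rintro a b hab ha ⟨u, hu⟩
      generalize hb : linv a = a' at hu
      cases hu with
      | here => subst hb; exact Γ.irrefl hab
      | skip _ hu => subst hb; exact ha ⟨_, hu⟩
    rw [push_of_not ha, push_of_not hb, push_of_not (h1 hab ha), push_of_not (h1 hab.symm hb)]
    exact .swap _ hab

/-- The action of a letter on classes of reduced words. -/
noncomputable def pushClass (a : V × Bool) : RedClass Γ → RedClass Γ :=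
  Quotient.map (sa := redSetoid Γ) (sb := redSetoid Γ)
    (fun w => ⟨push (Γ := Γ) a w.1, w.2.push⟩) fun _ _ h => TEq.push h

lemma pushClass_linv (a : V × Bool) (y : RedClass Γ) :
    pushClass (linv a) (pushClass a y) = y := by
  induction y using Quotient.inductionOn with
  | h w => exact Quotient.sound (s := redSetoid Γ) (push_push_linv w.2)

/-- The permutation of classes of reduced words given by a generator. -/
noncomputable def pushPerm (v : V) : Equiv.Perm (RedClass Γ) where
  toFun := pushClass (v, true)
  invFun := pushClass (v, false)
  left_inv y := pushClass_linv (v, true) y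
  right_inv y := pushClass_linv (v, false) y

/-- The (inverted) right action of the group on classes of reduced words. -/
noncomputable def pushHom : RAAG Γ →* Equiv.Perm (RedClass Γ) :=
  lift (fun v => (pushPerm v)⁻¹) fun v w h => by
    refine Commute.inv_inv ?_
    ext y
    induction y using Quotient.inductionOn with
    | h x => exact Quotient.sound (s := redSetoid Γ) (push_comm (a := (v, true)) (b := (w, true)) h)

lemma pushHom_letterVal_inv (a : V × Bool) (y : RedClass Γ) :
    (pushHom (letterVal Γ a))⁻¹ y = pushClass a y := by
  rcases a with ⟨v, _ | _⟩ <;> rfl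

lemma pushHom_val_inv {w : List (V × Bool)} (hw : Red Γ w) :
    (pushHom (val Γ w))⁻¹ (Quotient.mk (redSetoid Γ) ⟨[], trivial⟩) =
      Quotient.mk (redSetoid Γ) ⟨w, hw⟩ := by
  induction w with
  | nil => simp
  | cons a w ih =>
    rw [val_cons, map_mul, mul_inv_rev, Equiv.Perm.mul_apply, ih hw.1, pushHom_letterVal_inv]
    apply Quotient.sound (s := redSetoid Γ)
    change TEq Γ (push (Γ := Γ) a w) (a :: w)
    rw [push_of_not]
    rintro ⟨u, hu⟩
    exact hw.2 _ hu

lemma Red.teq_of_val_eq {w w' : List (V × Bool)} (hw : Red Γ w) (hw' : Red Γ w')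
    (h : val Γ w = val Γ w') : TEq Γ w w' := by
  have h1 := pushHom_val_inv hw
  rw [h, pushHom_val_inv hw'] at h1
  exact (Quotient.exact (s := redSetoid Γ) h1).symm

variable (Γ) in
lemma exists_red_length_le (w : List (V × Bool)) :
    ∃ w', Red Γ w' ∧ val Γ w' = val Γ w ∧ w'.length ≤ w.length := by
  induction w with
  | nil => exact ⟨[], trivial, rfl, le_rfl⟩
  | cons a w ih =>
    obtain ⟨w', h1, h2, h3⟩ := ih
    by_cases h : ∃ u, Strip Γ (linv a) w' u
    · obtain ⟨u, hu⟩ := h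
      refine ⟨u, h1.strip hu, ?_, ?_⟩
      · rw [val_cons, ← h2, hu.teq.val_eq]
        simp
      · have := hu.teq.length_eq
        simp only [List.length_cons] at this ⊢
        omega
    · exact ⟨a :: w', ⟨h1, fun u hu => h ⟨u, hu⟩⟩, by simp [h2], by simpa using h3⟩

variable (Γ) in
lemma exists_red (g : RAAG Γ) : ∃ w, Red Γ w ∧ val Γ w = g := by
  obtain ⟨w, rfl⟩ := exists_val_eq Γ g
  obtain ⟨w', h1, h2, -⟩ := exists_red_length_le Γ w
  exact ⟨w', h1, h2⟩

lemma Red.wordLength_eq {w : List (V × Bool)} (hw : Red Γ w) :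
    wordLength (raagGen Γ) (val Γ w) = w.length := by
  refine le_antisymm (wordLength_val_le Γ w) ?_
  obtain ⟨v, h1, h2⟩ := exists_val_length_eq Γ (val Γ w)
  obtain ⟨w', h3, h4, h5⟩ := exists_red_length_le Γ v
  rw [← (h3.teq_of_val_eq hw (h4.trans h1)).length_eq]
  omega

end NormalForm

end RAAG

/-! ### Rewriting machines between right-angled Artin groups -/

namespace RAAG

section Gate

variable {V : Type*} {Γ : SimpleGraph V}

lemma red_append_iff {v w : List (V × Bool)} (hv : Red Γ v) (hw : Red Γ w) :
    Red Γ (v ++ w) ↔ ∀ A a B B' C, v = A ++ a :: B → w = B' ++ linv a :: C →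
      ¬ ∀ b ∈ B ++ B', Γ.Adj a.1 b.1 := by
  rw [red_iff]
  constructor
  · rintro h A a B B' C rfl rfl
    exact h A a (B ++ B') C (by simp)
  · rintro h A a B C he hB
    rcases List.append_eq_append_iff.1 he with ⟨A', h1, h2⟩ | ⟨A', h1, h2⟩
    · exact (red_iff.1 hw) A' a B C h2 hB
    · cases A' with
      | nil => exact (red_iff.1 hw) [] a B C (by simpa using h2.symm) hB
      | cons a' A' =>
        simp only [List.cons_append, List.cons.injEq] at h2
        obtain ⟨rfl, h2⟩ := h2
        rcases List.append_eq_append_iff.1 h2 with ⟨B', h3, h4⟩ | ⟨B', h3, h4⟩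
        · cases B' with
          | nil =>
            refine h A a B [] C (by simp [h1, h3]) (by simpa using h4.symm) ?_
            simpa using hB
          | cons b B' =>
            simp only [List.cons_append, List.cons.injEq] at h4
            obtain ⟨rfl, h4⟩ := h4
            exact (red_iff.1 hv) A a B B' (by rw [h1, h3]) hB
        · refine h A a A' B' C h1 h4 ?_
          rwa [← h3]

/-- Two reduced words have a greatest common initial piece, up to shuffling. -/
lemma exists_gate (X Y : List (V × Bool)) (hX : Red Γ X) (hY : Red Γ Y) :
    ∃ P X' Y', TEq Γ X (X' ++ P) ∧ TEq Γ Y (Y' ++ P) ∧ Red Γ (Y' ++ invw X') := by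
  by_cases h : Red Γ (Y ++ invw X)
  · exact ⟨[], X, Y, by simpa using TEq.refl X, by simpa using TEq.refl Y, h⟩
  · rw [red_append_iff hY hX.invw] at h
    push Not at h
    obtain ⟨A, a, B, B', C, rfl, hw, hB⟩ := h
    have hXe : X = invw C ++ a :: invw B' := by
      simpa using congrArg invw hw
    have hB1 : ∀ b ∈ B, Γ.Adj a.1 b.1 := fun b hb => hB b (by simp [hb])
    have hB2 : ∀ b ∈ invw B', Γ.Adj a.1 b.1 := by
      intro b hb
      simp only [invw, List.mem_reverse, List.mem_map] at hb
      obtain ⟨c, hc, rfl⟩ := hb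
      exact hB c (by simp [hc])
    have t1 : TEq Γ (A ++ a :: B) ((A ++ B) ++ [a]) := by
      rw [List.append_assoc]; exact (teq_cons_append hB1).append_left A
    have t2 : TEq Γ (invw C ++ a :: invw B') ((invw C ++ invw B') ++ [a]) := by
      rw [List.append_assoc]; exact (teq_cons_append hB2).append_left _
    have hlen : (invw C ++ invw B').length < X.length := by simp [hXe]
    rw [← hXe] at t2
    obtain ⟨P, X', Y', h1, h2, h3⟩ := exists_gate (invw C ++ invw B') (A ++ B)
      (hX.of_teq t2).left (hY.of_teq t1).left
    refine ⟨P ++ [a], X', Y', ?_, ?_, h3⟩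
    · rw [← List.append_assoc]; exact t2.trans (h1.append_right _)
    · rw [← List.append_assoc]; exact t1.trans (h2.append_right _)
termination_by X.length

end Gate

section Rep

variable {V : Type*} {Γ : SimpleGraph V}

/-- `Rep w w'`: the word `w'` arises from `w` by repeating some letters twice. -/
inductive Rep : List (V × Bool) → List (V × Bool) → Prop
  | nil : Rep [] []
  | one (a) {w w'} : Rep w w' → Rep (a :: w) (a :: w')
  | two (a) {w w'} : Rep w w' → Rep (a :: w) (a :: a :: w')

lemma Rep.append {v v' w w' : List (V × Bool)} (h : Rep v v') (h' : Rep w w') :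
    Rep (v ++ w) (v' ++ w') := by
  induction h with
  | nil => exact h'
  | one a _ ih => exact .one a ih
  | two a _ ih => exact .two a ih

lemma Rep.invw {w w' : List (V × Bool)} (h : Rep w w') : Rep (invw w) (invw w') := by
  induction h with
  | nil => exact .nil
  | one a _ ih =>
    rw [invw_cons, invw_cons]; exact ih.append (.one _ .nil)
  | two a _ ih =>
    rw [invw_cons, invw_cons, invw_cons, List.append_assoc]
    exact ih.append (.two _ .nil)

lemma Rep.length_le {w w' : List (V × Bool)} (h : Rep w w') : w.length ≤ w'.length := by
  induction h with
  | nil => exact le_rfl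
  | one a _ ih => simpa using ih
  | two a _ ih => simp only [List.length_cons]; omega

lemma Rep.strip {a : V × Bool} {w w' u' : List (V × Bool)} (h : Rep w w')
    (hs : Strip Γ a w' u') : ∃ u, Strip Γ a w u := by
  induction h generalizing u' with
  | nil => cases hs
  | one b _ ih =>
    cases hs with
    | here => exact ⟨_, .here _⟩
    | skip hab hs =>
      obtain ⟨u, hu⟩ := ih hs
      exact ⟨_, .skip hab hu⟩
  | two b _ ih =>
    cases hs with
    | here => exact ⟨_, .here _⟩
    | skip hab hs =>
      cases hs with
      | here => exact (Γ.irrefl hab).elim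
      | skip _ hs =>
        obtain ⟨u, hu⟩ := ih hs
        exact ⟨_, .skip hab hu⟩

lemma Rep.red {w w' : List (V × Bool)} (h : Rep w w') (hw : Red Γ w) : Red Γ w' := by
  induction h with
  | nil => exact hw
  | one a h ih =>
    refine ⟨ih hw.1, fun u hu => ?_⟩
    obtain ⟨x, hx⟩ := h.strip hu
    exact hw.2 _ hx
  | two a h ih =>
    have key : ∀ u, ¬ Strip Γ (linv a) _ u := fun u hu => by
      obtain ⟨x, hx⟩ := h.strip hu
      exact hw.2 _ hx
    refine ⟨⟨ih hw.1, key⟩, fun u hu => ?_⟩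
    generalize ha : linv a = a' at hu
    cases hu with
    | here => exact linv_ne _ ha
    | skip hab _ => subst ha; exact Γ.irrefl hab

/-- Positive letters are doubled, negative letters are kept. -/
def dbl (a : V × Bool) : List (V × Bool) := if a.2 then [a, a] else [a]

/-- The word with all positive letters doubled. -/
def dblw : List (V × Bool) → List (V × Bool)
  | [] => []
  | a :: w => dbl a ++ dblw w

lemma dblw_append (v w : List (V × Bool)) : dblw (v ++ w) = dblw v ++ dblw w := by
  induction v with
  | nil => rfl
  | cons a v ih => simp [dblw, ih]

lemma rep_dblw (w : List (V × Bool)) : Rep w (dblw w) := by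
  induction w with
  | nil => exact .nil
  | cons a w ih =>
    rcases a with ⟨v, _ | _⟩
    · exact .one _ ih
    · exact .two _ ih

lemma val_dbl_commute {a b : V × Bool} (h : Γ.Adj a.1 b.1) :
    Commute (val Γ (dbl a)) (val Γ (dbl b)) := by
  have := letterVal_commute Γ h
  rcases a with ⟨v, _ | _⟩ <;> rcases b with ⟨w, _ | _⟩ <;>
    simp only [dbl, val_cons, val_nil, one_mul, if_true, if_false, Bool.false_eq_true]
  · exact this
  · exact this.mul_right this
  · exact this.mul_left this
  · exact (this.mul_right this).mul_left (this.mul_right this)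

lemma TEq.val_dblw_eq {w w' : List (V × Bool)} (h : TEq Γ w w') :
    val Γ (dblw w) = val Γ (dblw w') := by
  induction h with
  | nil => rfl
  | cons a _ ih => simp [dblw, ih]
  | swap w h => simp [dblw, mul_assoc, (val_dbl_commute h).eq]
  | trans _ _ h1 h2 => exact h1.trans h2

end Rep

/-- A state machine relabelling the letters of words over `Γ` by vertices of `Λ`. -/
structure Machine {V U : Type*} (Γ : SimpleGraph V) (Λ : SimpleGraph U) (S : Type*) where
  /-- The label of a letter in a given state. -/
  c : S → V → U
  /-- The state transition after reading a letter. -/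
  τ : V → S → S
  c_inj : ∀ σ, Function.Injective (c σ)
  adj : ∀ σ i j, Γ.Adj i j → Λ.Adj (c σ i) (c σ j)
  c_self : ∀ σ i, c (τ i σ) i = c σ i
  c_adj : ∀ σ i j, Γ.Adj i j → c (τ i σ) j = c σ j
  τ_comm : ∀ σ i j, Γ.Adj i j → τ i (τ j σ) = τ j (τ i σ)
  chordless : ∀ σ i j, i ≠ j → ¬ Γ.Adj i j → ¬ Λ.Adj (c (τ i σ) i) (c (τ i σ) j)

namespace Machine

variable {V U S : Type*} {Γ : SimpleGraph V} {Λ : SimpleGraph U} (M : Machine Γ Λ S)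

/-- The state after reading a word. -/
def st (σ : S) : List (V × Bool) → S
  | [] => σ
  | a :: w => M.τ a.1 (st σ w)

/-- The relabelled word. -/
def im (σ : S) : List (V × Bool) → List (U × Bool)
  | [] => []
  | a :: w => (M.c (M.st σ w) a.1, a.2) :: im σ w

lemma st_append (σ : S) (v w : List (V × Bool)) : M.st σ (v ++ w) = M.st (M.st σ w) v := by
  induction v with
  | nil => rfl
  | cons a v ih => simp [st, ih]

lemma im_append (σ : S) (v w : List (V × Bool)) :
    M.im σ (v ++ w) = M.im (M.st σ w) v ++ M.im σ w := by
  induction v with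
  | nil => rfl
  | cons a v ih => simp [im, ih, st_append]

lemma length_im (σ : S) (w : List (V × Bool)) : (M.im σ w).length = w.length := by
  induction w with
  | nil => rfl
  | cons a w ih => simp [im, ih]

lemma st_teq (σ : S) {w w' : List (V × Bool)} (h : TEq Γ w w') : M.st σ w = M.st σ w' := by
  induction h with
  | nil => rfl
  | cons a _ ih => simp [st, ih]
  | swap w h => exact M.τ_comm _ _ _ h
  | trans _ _ h1 h2 => exact h1.trans h2

lemma im_teq (σ : S) {w w' : List (V × Bool)} (h : TEq Γ w w') :
    TEq Λ (M.im σ w) (M.im σ w') := by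
  induction h with
  | nil => exact .nil
  | cons a h ih => simpa [im, M.st_teq σ h] using TEq.cons _ ih
  | swap w h =>
    simp only [im, st]
    rw [M.c_adj _ _ _ h, M.c_adj _ _ _ h.symm]
    exact .swap _ (M.adj _ _ _ h)
  | trans _ _ h1 h2 => exact h1.trans h2

lemma adj_of_adj {σ : S} {i j : V} (h : Λ.Adj (M.c (M.τ j σ) i) (M.c σ j)) :
    Γ.Adj i j ∧ M.c (M.τ j σ) i = M.c σ i := by
  rw [← M.c_self σ j] at h
  have hne : j ≠ i := by rintro rfl; exact Λ.irrefl h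
  have hadj : Γ.Adj j i := by
    by_contra hn
    exact M.chordless σ j i hne hn h.symm
  exact ⟨hadj.symm, M.c_adj _ _ _ hadj⟩

lemma strip_of_strip_im {σ : S} {i : V} {δ : Bool} {w : List (V × Bool)} {u' : List (U × Bool)}
    (h : Strip Λ (M.c (M.st σ w) i, δ) (M.im σ w) u') : ∃ u, Strip Γ (i, δ) w u := by
  induction w generalizing u' with
  | nil => cases h
  | cons b w ih =>
    rw [strip_iff] at h
    obtain ⟨B, C, h1, h2, h3⟩ := h
    cases B with
    | nil =>
      simp only [im, st, List.nil_append, List.cons.injEq, Prod.mk.injEq] at h1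
      obtain ⟨⟨h4, h5⟩, -⟩ := h1
      rw [← M.c_self] at h4
      have := M.c_inj _ h4
      obtain rfl : b = (i, δ) := Prod.ext this h5
      exact ⟨_, .here _⟩
    | cons b' B =>
      simp only [im, st, List.cons_append, List.cons.injEq] at h1
      obtain ⟨rfl, h1⟩ := h1
      obtain ⟨hadj, hc⟩ := M.adj_of_adj (h3 _ List.mem_cons_self)
      simp only [st, hc] at h3 h1
      obtain ⟨u, hu⟩ := ih (u' := B ++ C)
        (strip_iff.2 ⟨B, C, h1, rfl, fun b hb => h3 b (List.mem_cons_of_mem _ hb)⟩)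
      exact ⟨_, .skip hadj hu⟩

lemma red_im {σ : S} {w : List (V × Bool)} (hw : Red Γ w) : Red Λ (M.im σ w) := by
  induction w with
  | nil => trivial
  | cons a w ih =>
    refine ⟨ih hw.1, fun u hu => ?_⟩
    obtain ⟨u, hu⟩ := M.strip_of_strip_im hu
    exact hw.2 _ hu

lemma passing {σ : S} {k : V} {w : List (V × Bool)}
    (h : ∀ b ∈ M.im σ w, Λ.Adj (M.c (M.st σ w) k) b.1) :
    (∀ b ∈ w, Γ.Adj k b.1) ∧ M.c (M.st σ w) k = M.c σ k := by
  induction w with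
  | nil => exact ⟨by simp, rfl⟩
  | cons b w ih =>
    simp only [im, st] at h
    obtain ⟨hadj, hc⟩ := M.adj_of_adj (h _ List.mem_cons_self)
    rw [hc] at h
    obtain ⟨h1, h2⟩ := ih fun b hb => h b (List.mem_cons_of_mem _ hb)
    refine ⟨?_, hc.trans h2⟩
    simpa [hadj] using h1

lemma im_split {σ : S} {w : List (V × Bool)} {A B : List (U × Bool)} {a : U × Bool}
    (h : M.im σ w = A ++ a :: B) :
    ∃ w1 x w2, w = w1 ++ x :: w2 ∧ a = (M.c (M.st σ w2) x.1, x.2) ∧ B = M.im σ w2 := by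
  induction w generalizing A with
  | nil => simp [im] at h
  | cons b w ih =>
    cases A with
    | nil =>
      simp only [im, List.nil_append, List.cons.injEq] at h
      exact ⟨[], b, w, rfl, h.1.symm, h.2.symm⟩
    | cons a' A =>
      simp only [im, List.cons_append, List.cons.injEq] at h
      obtain ⟨w1, x, w2, rfl, h2, h3⟩ := ih h.2
      exact ⟨b :: w1, x, w2, rfl, h2, h3⟩

lemma red_im_append {σ : S} {X Y : List (V × Bool)} (h : Red Γ (Y ++ invw X)) :
    Red Λ (M.im σ Y ++ invw (M.im σ X)) := by
  have hX : Red Γ X := by simpa using h.right.invw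
  rw [red_append_iff (M.red_im h.left) (M.red_im hX).invw]
  intro A a B B' C h1 h2 hB
  have h2' : M.im σ X = invw C ++ a :: invw B' := by
    simpa using congrArg invw h2
  obtain ⟨Y1, y, Y2, rfl, rfl, rfl⟩ := M.im_split h1
  obtain ⟨X1, x, X2, rfl, hyx, hB'⟩ := M.im_split h2'
  simp only [Prod.mk.injEq] at hyx
  obtain ⟨hy1, hy2⟩ := M.passing (k := y.1) fun b hb => hB b (by simp [hb])
  obtain ⟨hx1, hx2⟩ := M.passing (σ := σ) (w := X2) (k := x.1) fun b hb => by
    rw [← hB'] at hb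
    simp only [invw, List.mem_reverse, List.mem_map] at hb
    obtain ⟨c, hc, rfl⟩ := hb
    rw [← hyx.1]
    exact hB c (by simp [hc])
  have hxy : y = x := Prod.ext (M.c_inj σ (by rw [← hy2, hyx.1, hx2])) hyx.2
  subst hxy
  refine red_iff.1 h Y1 y (Y2 ++ invw X2) (invw X1) (by simp) ?_
  intro b hb
  rcases List.mem_append.1 hb with hb | hb
  · exact hy1 b hb
  · simp only [invw, List.mem_reverse, List.mem_map] at hb
    obtain ⟨c, hc, rfl⟩ := hb
    exact hx1 c hc

/-- The map of groups induced by a machine, with positive letters doubled. -/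
noncomputable def map (σ : S) (g : RAAG Γ) : RAAG Λ :=
  val Λ (dblw (M.im σ (exists_red Γ g).choose))

/-- The state reached after reading a reduced word of a group element. -/
noncomputable def state (σ : S) (g : RAAG Γ) : S := M.st σ (exists_red Γ g).choose

lemma map_val (σ : S) {w : List (V × Bool)} (hw : Red Γ w) :
    M.map σ (val Γ w) = val Λ (dblw (M.im σ w)) :=
  TEq.val_dblw_eq (M.im_teq σ ((exists_red Γ (val Γ w)).choose_spec.1.teq_of_val_eq hw
    (exists_red Γ (val Γ w)).choose_spec.2))

lemma state_val (σ : S) {w : List (V × Bool)} (hw : Red Γ w) :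
    M.state σ (val Γ w) = M.st σ w :=
  M.st_teq σ ((exists_red Γ (val Γ w)).choose_spec.1.teq_of_val_eq hw
    (exists_red Γ (val Γ w)).choose_spec.2)

lemma wordLength_le_map (σ : S) (g h : RAAG Γ) : wordLength (raagGen Γ) (g⁻¹ * h) ≤
    wordLength (raagGen Λ) ((M.map σ g)⁻¹ * M.map σ h) := by
  obtain ⟨X, hX, rfl⟩ := exists_red Γ g
  obtain ⟨Y, hY, rfl⟩ := exists_red Γ h
  obtain ⟨P, X', Y', h1, h2, h3⟩ := exists_gate X Y hX hY
  rw [h1.val_eq, h2.val_eq, M.map_val σ (hX.of_teq h1), M.map_val σ (hY.of_teq h2)]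
  set ρ := M.st σ P
  have e1 : (val Γ (X' ++ P))⁻¹ * val Γ (Y' ++ P) = val Γ (Y' ++ invw X') := by
    simp only [val_append, val_invw]; group
  have e2 : (val Λ (dblw (M.im σ (X' ++ P))))⁻¹ * val Λ (dblw (M.im σ (Y' ++ P))) =
      val Λ (dblw (M.im ρ Y') ++ invw (dblw (M.im ρ X'))) := by
    simp only [im_append, dblw_append, val_append, val_invw, ρ]; group
  have hrep : Rep (M.im ρ Y' ++ invw (M.im ρ X'))
      (dblw (M.im ρ Y') ++ invw (dblw (M.im ρ X'))) :=
    (rep_dblw _).append (rep_dblw _).invw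
  rw [e1, e2, h3.wordLength_eq, (hrep.red (M.red_im_append h3)).wordLength_eq]
  refine le_trans (le_of_eq ?_) hrep.length_le
  simp [length_im]

lemma step (σ : S) (g : RAAG Γ) (a : V × Bool) :
    (M.state σ (g * letterVal Γ a) = M.τ a.1 (M.state σ g) ∧
      M.map σ (g * letterVal Γ a) = M.map σ g * val Λ (dbl (M.c (M.state σ g) a.1, a.2))) ∨
    (M.state σ g = M.τ a.1 (M.state σ (g * letterVal Γ a)) ∧
      M.map σ g = M.map σ (g * letterVal Γ a) *
        val Λ (dbl (M.c (M.state σ (g * letterVal Γ a)) a.1, !a.2))) := by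
  have key : ∀ (a : V × Bool) (w : List (V × Bool)), Red Γ (a :: w) →
      M.state σ (val Γ w * letterVal Γ a) = M.τ a.1 (M.state σ (val Γ w)) ∧
      M.map σ (val Γ w * letterVal Γ a) =
        M.map σ (val Γ w) * val Λ (dbl (M.c (M.state σ (val Γ w)) a.1, a.2)) := by
    intro a w hw
    rw [← val_cons, M.state_val σ hw, M.state_val σ hw.1, M.map_val σ hw, M.map_val σ hw.1]
    simp [st, im, dblw]
  obtain ⟨w, hw, rfl⟩ := exists_red Γ g
  by_cases h : ∃ u, Strip Γ (linv a) w u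
  · right
    obtain ⟨u, hu⟩ := h
    have e := hu.teq.val_eq
    have e' : val Γ w * letterVal Γ a = val Γ u := by simp [e]
    rw [e', e]
    exact key (linv a) u (hw.of_teq hu.teq)
  · left
    exact key a w ⟨hw, fun u hu => h ⟨u, hu⟩⟩

lemma map_pow (σ : S) (a : V × Bool) (ha : M.τ a.1 σ = σ) (k : ℕ) :
    M.map σ (letterVal Γ a ^ k) = val Λ (dbl (M.c σ a.1, a.2)) ^ k ∧
      M.state σ (letterVal Γ a ^ k) = σ := by
  have hred : Red Γ (List.replicate k a) := by
    rw [red_iff]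
    intro A b B C h _
    have h1 : b ∈ List.replicate k a := by simp [h]
    have h2 : linv b ∈ List.replicate k a := by simp [h]
    rw [List.eq_of_mem_replicate h1] at h2
    exact linv_ne _ (List.eq_of_mem_replicate h2)
  have hval : val Γ (List.replicate k a) = letterVal Γ a ^ k := by
    clear hred
    induction k with
    | zero => simp
    | succ k ih => rw [List.replicate_succ, val_cons, ih, pow_succ]
  rw [← hval, M.map_val σ hred, M.state_val σ hred]
  clear hred hval
  induction k with
  | zero => simp [im, st, dblw]
  | succ k ih =>
    rw [List.replicate_succ]
    simp only [im, st, dblw, val_append, ih.1, ih.2, ha, pow_succ, and_self]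

end Machine

end RAAG

/-! ### Cycle graphs -/

namespace CycleIndex

/-- Cyclic adjacency of residues, expressed with natural numbers below `m`. -/
def Cyc (m a b : ℕ) : Prop := b = a + 1 ∨ a = b + 1 ∨ (a = 0 ∧ b + 1 = m) ∨ (b = 0 ∧ a + 1 = m)

variable {m : ℕ}

lemma Cyc.symm {a b : ℕ} (h : Cyc m a b) : Cyc m b a := by
  unfold Cyc at *; omega

lemma adj_sub_iff (i j r : ZMod m) :
    (cycleGraph m).Adj (i - r) (j - r) ↔ (cycleGraph m).Adj i j := by
  simp only [cycleGraph, SimpleGraph.fromRel_adj, ne_eq, sub_left_inj]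
  have h1 : j - r = i - r + 1 ↔ j = i + 1 := by
    constructor <;> intro h <;> linear_combination h
  have h2 : i - r = j - r + 1 ↔ i = j + 1 := by
    constructor <;> intro h <;> linear_combination h
  rw [h1, h2]

lemma adj_sub_left_iff (i j r : ZMod m) :
    (cycleGraph m).Adj (r - i) (r - j) ↔ (cycleGraph m).Adj i j := by
  simp only [cycleGraph, SimpleGraph.fromRel_adj, ne_eq, sub_right_inj]
  have h1 : r - j = r - i + 1 ↔ i = j + 1 := by
    constructor <;> intro h <;> linear_combination h
  have h2 : r - i = r - j + 1 ↔ j = i + 1 := by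
    constructor <;> intro h <;> linear_combination h
  rw [h1, h2, or_comm]

variable [NeZero m]

lemma val_add_one_eq (hm : 3 ≤ m) (i : ZMod m) :
    (i + 1).val = if i.val + 1 = m then 0 else i.val + 1 := by
  have h1 : (1 : ZMod m).val = 1 := by
    rw [ZMod.val_one_eq_one_mod, Nat.mod_eq_of_lt (by omega)]
  have h2 := i.val_lt
  rw [ZMod.val_add, h1]
  split_ifs with h
  · rw [h, Nat.mod_self]
  · exact Nat.mod_eq_of_lt (by omega)

lemma eq_add_one_iff (hm : 3 ≤ m) (i j : ZMod m) :
    j = i + 1 ↔ j.val = i.val + 1 ∨ (j.val = 0 ∧ i.val + 1 = m) := by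
  rw [← (ZMod.val_injective m).eq_iff, val_add_one_eq hm]
  have h2 := j.val_lt
  split_ifs with h <;> omega

lemma adj_iff (hm : 3 ≤ m) (i j : ZMod m) :
    (cycleGraph m).Adj i j ↔ Cyc m i.val j.val := by
  rw [cycleGraph, SimpleGraph.fromRel_adj, eq_add_one_iff hm, eq_add_one_iff hm, Ne,
    ← (ZMod.val_injective m).eq_iff]
  unfold Cyc
  omega

lemma val_sub_eq (i r : ZMod m) :
    (i - r).val = if r.val ≤ i.val then i.val - r.val else i.val + m - r.val := by
  have h1 := i.val_lt
  have h2 := r.val_lt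
  split_ifs with h
  · exact ZMod.val_sub h
  · have : i - r = ((i.val + m - r.val : ℕ) : ZMod m) := by
      rw [Nat.cast_sub (by omega)]; simp
    rw [this, ZMod.val_natCast, Nat.mod_eq_of_lt (by omega)]

end CycleIndex

/-! ### The ladder graph with leaf chains -/

namespace Ladder

open CycleIndex

/-- Vertices of the ladder graph: the two rails and the chains attached to the rungs. -/
inductive LV
  | top (y : ℤ)
  | bot (y : ℤ)
  | lf (t : ℤ) (ε : Bool) (k : ℕ)

/-- The sign of a Boolean. -/
def sgn (ε : Bool) : ℤ := if ε then 1 else -1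

/-- The generating edges of the ladder graph. -/
inductive Edge (N p : ℕ) : LV → LV → Prop
  | top (y : ℤ) : Edge N p (.top y) (.top (y + 1))
  | bot (y : ℤ) : Edge N p (.bot y) (.bot (y + 1))
  | rung (t : ℤ) : Edge N p (.top (2 * t)) (.bot (N * t))
  | lf (t : ℤ) (ε : Bool) (k : ℕ) : 1 ≤ k → k + 1 ≤ p * N → Edge N p (.lf t ε k) (.lf t ε (k + 1))
  | first (t : ℤ) (ε : Bool) : Edge N p (.lf t ε 1) (.top (2 * t + sgn ε))
  | last (t : ℤ) (ε : Bool) : Edge N p (.lf t ε (p * N)) (.bot (N * t - sgn ε))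

/-- The ladder graph. -/
def graph (N p : ℕ) : SimpleGraph LV := SimpleGraph.fromRel (Edge N p)

lemma Edge.ne {N p : ℕ} {a b : LV} (h : Edge N p a b) : a ≠ b := by
  cases h <;> simp

lemma graph_adj {N p : ℕ} {a b : LV} : (graph N p).Adj a b ↔ Edge N p a b ∨ Edge N p b a := by
  rw [graph, SimpleGraph.fromRel_adj]
  constructor
  · exact And.right
  · rintro (h | h)
    · exact ⟨h.ne, .inl h⟩
    · exact ⟨h.ne.symm, .inr h⟩

lemma Edge.adj {N p : ℕ} {a b : LV} (h : Edge N p a b) : (graph N p).Adj a b :=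
  graph_adj.2 (.inl h)

/-- Vertices of the ladder graph which belong to the rails or to the proper range of a chain. -/
def InRange (N p : ℕ) : LV → Prop
  | .top _ => True
  | .bot _ => True
  | .lf _ _ k => 1 ≤ k ∧ k ≤ p * N

/-- The states of the machine: a rung, a side, and a base point on the cycle. -/
structure State (m : ℕ) where
  /-- The current rung. -/
  l : ℤ
  /-- The current side. -/
  ε : Bool
  /-- The base point. -/
  r : ZMod m

/-- The number of vertices of the upper rail in a side. -/
def tc (q : ℕ) (ε : Bool) : ℕ := if ε then 2 * q + 4 else 2 * q + 2

/-- The closed walk in the ladder graph attached to a state. -/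
def walk (N p q m : ℕ) (l : ℤ) (ε : Bool) (k : ℕ) : LV :=
  if k < tc q ε then .top (2 * (l - 1 - q) + k)
  else if k < tc q ε + p * N then .lf l ε (k - tc q ε + 1)
  else .bot (N * (l - 1 - q) + (m - 1 - k))

section Walk

variable {N p q m : ℕ} {l : ℤ} {ε : Bool} {k : ℕ}

lemma walk_eq_top {y : ℤ} : walk N p q m l ε k = .top y ↔
    k < tc q ε ∧ y = 2 * (l - 1 - q) + k := by
  unfold walk
  split_ifs <;> simp [*, eq_comm]

lemma walk_eq_lf {t : ℤ} {ε' : Bool} {j : ℕ} : walk N p q m l ε k = .lf t ε' j ↔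
    tc q ε ≤ k ∧ k < tc q ε + p * N ∧ t = l ∧ ε' = ε ∧ j = k - tc q ε + 1 := by
  unfold walk
  split_ifs with h1 h2
  · simp [h1]
  · simp only [LV.lf.injEq]
    have : tc q ε ≤ k := by omega
    simp only [h2, this, true_and]
    exact ⟨fun ⟨a, b, c⟩ => ⟨a.symm, b.symm, c.symm⟩, fun ⟨a, b, c⟩ => ⟨a.symm, b.symm, c.symm⟩⟩
  · simp [h2]

lemma walk_eq_bot {y : ℤ} : walk N p q m l ε k = .bot y ↔
    tc q ε + p * N ≤ k ∧ y = N * (l - 1 - q) + (m - 1 - k) := by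
  unfold walk
  split_ifs with h1 h2
  · simp; omega
  · simp; omega
  · simp only [LV.bot.injEq]
    constructor
    · rintro rfl; exact ⟨by omega, rfl⟩
    · rintro ⟨-, rfl⟩; rfl

end Walk

end Ladder

namespace Ladder

open CycleIndex

section Walk

variable {N p q m : ℕ} (hN : 3 ≤ N) (hp : 1 ≤ p)
  (hm : m = N + 4 + p * N + q * (N + 2))

lemma walk_inj {l : ℤ} {ε : Bool} {k k' : ℕ}
    (h : walk N p q m l ε k = walk N p q m l ε k') : k = k' := by
  cases h' : walk N p q m l ε k' with
  | top y =>
    rw [h'] at h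
    rw [walk_eq_top] at h h'
    omega
  | bot y =>
    rw [h'] at h
    rw [walk_eq_bot] at h h'
    omega
  | lf t ε' j =>
    rw [h'] at h
    rw [walk_eq_lf] at h h'
    omega

include hN hp hm in
lemma walk_adj {l : ℤ} {ε : Bool} {k k' : ℕ} (hk : k < m) (hk' : k' < m) (h : Cyc m k k') :
    (graph N p).Adj (walk N p q m l ε k) (walk N p q m l ε k') := by
  have hP : 3 ≤ p * N := by nlinarith
  have e1 : q * (N + 2) = q * N + 2 * q := by ring
  have e2 : (N : ℤ) * (l - 1 - q) = N * l - N - N * q := by ring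
  have e3 : N * q = q * N := by ring
  have e4 : (N : ℤ) * q = ((q * N : ℕ) : ℤ) := by push_cast; ring
  have key : ∀ k, k + 1 < m →
      (graph N p).Adj (walk N p q m l ε k) (walk N p q m l ε (k + 1)) := by
    intro k hk
    rcases lt_trichotomy (k + 1) (tc q ε) with h | h | h
    · rw [(walk_eq_top (N := N) (p := p) (m := m) (l := l)).2 ⟨by omega, rfl⟩,
        (walk_eq_top (N := N) (p := p) (m := m) (l := l)).2 ⟨h, rfl⟩]
      convert (Edge.top _).adj using 2
      push_cast; ring
    · rw [(walk_eq_top (N := N) (p := p) (m := m) (l := l)).2 ⟨by omega, rfl⟩,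
        (walk_eq_lf (N := N) (p := p) (m := m)).2 ⟨by omega, by omega, rfl, rfl, rfl⟩]
      have h1 : k + 1 - tc q ε + 1 = 1 := by omega
      have h2 : 2 * (l - 1 - q) + (k : ℤ) = 2 * l + sgn ε := by
        cases ε <;> simp [tc] at h <;> simp [sgn] <;> omega
      rw [h1, h2]
      exact (Edge.first _ _).adj.symm
    · rcases lt_trichotomy (k + 1) (tc q ε + p * N) with h' | h' | h'
      · rw [(walk_eq_lf (N := N) (p := p) (m := m)).2 ⟨by omega, by omega, rfl, rfl, rfl⟩,
          (walk_eq_lf (N := N) (p := p) (m := m)).2 ⟨by omega, by omega, rfl, rfl, rfl⟩]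
        have h1 : k + 1 - tc q ε + 1 = k - tc q ε + 1 + 1 := by omega
        rw [h1]
        exact (Edge.lf _ _ _ (by omega) (by omega)).adj
      · rw [(walk_eq_lf (N := N) (p := p) (m := m)).2 ⟨by omega, by omega, rfl, rfl, rfl⟩,
          (walk_eq_bot (N := N) (p := p) (m := m)).2 ⟨by omega, rfl⟩]
        have h1 : k - tc q ε + 1 = p * N := by omega
        have h2 : (N : ℤ) * (l - 1 - q) + (m - 1 - ((k + 1 : ℕ) : ℤ)) = N * l - sgn ε := by
          rw [e2, e4]
          cases ε <;> simp only [tc, sgn, if_true, if_false, Bool.false_eq_true] at h' ⊢ <;> omega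
        rw [h1, h2]
        exact (Edge.last _ _).adj
      · rw [(walk_eq_bot (N := N) (p := p) (m := m)).2 ⟨by omega, rfl⟩,
          (walk_eq_bot (N := N) (p := p) (m := m)).2 ⟨by omega, rfl⟩]
        refine SimpleGraph.Adj.symm ?_
        convert (Edge.bot _).adj using 2
        push_cast; ring
  have last : (graph N p).Adj (walk N p q m l ε 0) (walk N p q m l ε (m - 1)) := by
    rw [(walk_eq_top (N := N) (p := p) (m := m) (l := l)).2
        ⟨by unfold tc; split_ifs <;> omega, rfl⟩,
      (walk_eq_bot (N := N) (p := p) (m := m) (y := N * (l - 1 - q))).2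
        ⟨by unfold tc; split_ifs <;> omega, by push_cast [show 1 ≤ m by omega]; ring⟩]
    convert (Edge.rung _).adj using 2
    simp
  rcases h with rfl | rfl | ⟨rfl, h⟩ | ⟨rfl, h⟩
  · exact key _ hk'
  · exact (key _ hk).symm
  · obtain rfl : k' = m - 1 := by omega
    exact last
  · obtain rfl : k = m - 1 := by omega
    exact last.symm

/-- A label is active when it is an end of an inner rung of the current side. -/
def Active (N q : ℕ) (l : ℤ) : LV → Prop
  | .top y => ∃ t : ℤ, y = 2 * t ∧ l - 1 - q < t ∧ t < l
  | .bot y => ∃ t : ℤ, y = N * t ∧ l - 1 - q < t ∧ t < l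
  | .lf _ _ _ => False

include hN hp hm in
lemma walk_edge {l : ℤ} {ε : Bool} {k k' : ℕ} (hk : k < m) (hk' : k' < m)
    (h : Edge N p (walk N p q m l ε k) (walk N p q m l ε k')) :
    Cyc m k k' ∨ (Active N q l (walk N p q m l ε k) ∧ Active N q l (walk N p q m l ε k')) := by
  have hP : 3 ≤ p * N := by nlinarith
  have e1 : q * (N + 2) = q * N + 2 * q := by ring
  have e2 : (N : ℤ) * (l - 1 - q) = N * l - N - N * q := by ring
  have e4 : (N : ℤ) * q = ((q * N : ℕ) : ℤ) := by push_cast; ring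
  unfold Cyc
  generalize hx : walk N p q m l ε k = x at h
  generalize hy : walk N p q m l ε k' = y at h
  cases h with
  | top y =>
    rw [walk_eq_top] at hx hy; omega
  | bot y =>
    rw [walk_eq_bot] at hx hy; omega
  | lf t ε k _ _ =>
    rw [walk_eq_lf] at hx hy; omega
  | first t ε' =>
    rw [walk_eq_lf] at hx
    rw [walk_eq_top] at hy
    obtain ⟨h1, h2, rfl, rfl, h3⟩ := hx
    obtain ⟨h4, h5⟩ := hy
    left
    cases ε' <;> simp only [tc, sgn, if_true, if_false, Bool.false_eq_true] at * <;> omega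
  | last t ε' =>
    rw [walk_eq_lf] at hx
    rw [walk_eq_bot, e2, e4] at hy
    obtain ⟨h1, h2, rfl, rfl, h3⟩ := hx
    obtain ⟨h4, h5⟩ := hy
    left
    cases ε' <;> simp only [tc, sgn, if_true, if_false, Bool.false_eq_true] at * <;> omega
  | rung t =>
    rw [walk_eq_top] at hx
    rw [walk_eq_bot] at hy
    obtain ⟨h1, h2⟩ := hx
    obtain ⟨h3, h4⟩ := hy
    by_cases ht : l - 1 - q < t ∧ t < l
    · exact .inr ⟨⟨t, rfl, ht⟩, ⟨t, rfl, ht⟩⟩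
    · left
      have h5 : l - 1 - q ≤ t := by omega
      rcases eq_or_lt_of_le h5 with h6 | h6
      · rw [← h6] at h2 h4
        omega
      · exfalso
        have h7 : l ≤ t := by by_contra h; exact ht ⟨h6, by omega⟩
        obtain ⟨d, rfl⟩ : ∃ d : ℕ, t = l + d := ⟨(t - l).toNat, by omega⟩
        have e5 : (N : ℤ) * (l + d) = N * l + ((N * d : ℕ) : ℤ) := by push_cast; ring
        rw [e2, e4, e5] at h4
        cases ε <;> simp only [tc, if_true, if_false, Bool.false_eq_true] at h1 h3
        · omega
        · have : N * d ≤ 0 := by omega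
          omega

end Walk

section Machine

variable {N p q m : ℕ}

/-- The position of the distinguished vertex after a transition to a given side. -/
def cc (N q m : ℕ) (ε : Bool) : ℕ := if ε then 2 * q + 2 else m - 1 - N * (q + 1)

/-- The label of a vertex of the cycle in a state. -/
def label (N p q m : ℕ) (σ : State m) (i : ZMod m) : LV :=
  walk N p q m σ.l σ.ε (i - σ.r).val

/-- The transition of the machine. -/
def trans (N p q m : ℕ) (i : ZMod m) (σ : State m) : State m :=
  match label N p q m σ i with
  | .top y => if y % 2 = 0 ∧ 2 * (σ.l - 1 - q) < y ∧ y < 2 * σ.l then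
      ⟨y / 2, true, i - (cc N q m true : ℕ)⟩ else σ
  | .bot y => if y % N = 0 ∧ N * (σ.l - 1 - q) < y ∧ y < N * σ.l then
      ⟨y / N, false, i - (cc N q m false : ℕ)⟩ else σ
  | .lf _ _ _ => σ

lemma trans_top {σ : State m} {i : ZMod m} {t : ℤ} (h : label N p q m σ i = .top (2 * t))
    (h1 : σ.l - 1 - q < t) (h2 : t < σ.l) :
    trans N p q m i σ = ⟨t, true, i - (cc N q m true : ℕ)⟩ := by
  rw [trans, h]
  have e : 2 * t / 2 = t := by omega
  simp only [e]
  rw [if_pos (by omega)]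

lemma trans_bot (hN : 3 ≤ N) {σ : State m} {i : ZMod m} {t : ℤ}
    (h : label N p q m σ i = .bot (N * t)) (h1 : σ.l - 1 - q < t) (h2 : t < σ.l) :
    trans N p q m i σ = ⟨t, false, i - (cc N q m false : ℕ)⟩ := by
  rw [trans, h]
  have hN' : (0 : ℤ) < N := by omega
  have e : (N : ℤ) * t / N = t := Int.mul_ediv_cancel_left _ hN'.ne'
  simp only [e]
  rw [if_pos ⟨by simp, by gcongr, by gcongr⟩]

lemma trans_of_not (hN : 3 ≤ N) {σ : State m} {i : ZMod m}
    (h : ¬ Active N q σ.l (label N p q m σ i)) : trans N p q m i σ = σ := by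
  have hN' : (0 : ℤ) < N := by omega
  rw [trans]
  generalize label N p q m σ i = x at h
  cases x with
  | top y =>
    refine if_neg fun h' => h ⟨y / 2, by omega, by omega, by omega⟩
  | bot y =>
    refine if_neg fun h' => h ?_
    obtain ⟨t, rfl⟩ := Int.dvd_of_emod_eq_zero h'.1
    exact ⟨t, rfl, lt_of_mul_lt_mul_left h'.2.1 hN'.le, lt_of_mul_lt_mul_left h'.2.2 hN'.le⟩
  | lf => rfl

variable (hN : 3 ≤ N) (hp : 1 ≤ p)
  (hm : m = N + 4 + p * N + q * (N + 2))

lemma val_sub_trans [NeZero m] {σ : State m} {i j : ZMod m} (ε : Bool) (h : cc N q m ε < m) :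
    (i - (i - (cc N q m ε : ℕ))).val = cc N q m ε ∧
    ((j - σ.r).val = (i - σ.r).val + 1 → cc N q m ε + 1 < m →
      (j - (i - (cc N q m ε : ℕ))).val = cc N q m ε + 1) ∧
    ((i - σ.r).val = (j - σ.r).val + 1 → 0 < cc N q m ε →
      (j - (i - (cc N q m ε : ℕ))).val + 1 = cc N q m ε) := by
  set r' := i - (cc N q m ε : ZMod m)
  have h0 : (i - r').val = cc N q m ε := by
    rw [sub_sub_cancel, ZMod.val_natCast, Nat.mod_eq_of_lt h]
  have hi : i - r' = (i - σ.r) - (r' - σ.r) := by ring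
  have hj : j - r' = (j - σ.r) - (r' - σ.r) := by ring
  have b1 := (i - σ.r).val_lt
  have b2 := (j - σ.r).val_lt
  have b3 := (r' - σ.r).val_lt
  have v1 := val_sub_eq (i - σ.r) (r' - σ.r)
  have v2 := val_sub_eq (j - σ.r) (r' - σ.r)
  rw [← hi, h0] at v1
  rw [← hj] at v2
  refine ⟨h0, ?_, ?_⟩
  · intro h1 h2; split_ifs at v1 v2 <;> omega
  · intro h1 h2; split_ifs at v1 v2 <;> omega

/-- Labels which are never active. -/
def Passive (N : ℕ) : LV → Prop
  | .top y => y % 2 ≠ 0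
  | .bot y => ¬ (N : ℤ) ∣ y
  | .lf _ _ _ => True

lemma Passive.not_active {l : ℤ} {x : LV} (h : Passive N x) : ¬ Active N q l x := by
  cases x with
  | top y => rintro ⟨t, rfl, -⟩; simp [Passive] at h
  | bot y => rintro ⟨t, rfl, -⟩; simp [Passive] at h
  | lf => exact id

include hN hp hm in
lemma trans_spec [NeZero m] {σ : State m} {i : ZMod m}
    (h : Active N q σ.l (label N p q m σ i)) :
    label N p q m (trans N p q m i σ) i = label N p q m σ i ∧
    ¬ Active N q (trans N p q m i σ).l (label N p q m σ i) ∧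
    ∀ j, (cycleGraph m).Adj i j →
      label N p q m (trans N p q m i σ) j = label N p q m σ j ∧
      Passive N (label N p q m σ j) := by
  have hP : 3 ≤ p * N := by nlinarith
  have e1 : q * (N + 2) = q * N + 2 * q := by ring
  have e3 : N * (q + 1) = q * N + N := by ring
  have hk := (i - σ.r).val_lt
  have hN0 : (N : ℤ) ≠ 0 := by omega
  generalize hx : label N p q m σ i = x at h
  cases x with
  | lf => exact h.elim
  | top y =>
    obtain ⟨t, rfl, h1, h2⟩ := h
    rw [trans_top hx h1 h2]
    have hx' := hx
    rw [label, walk_eq_top] at hx'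
    have hcc : cc N q m true = 2 * q + 2 := rfl
    refine ⟨?_, ?_, ?_⟩
    · obtain ⟨v1, -, -⟩ := val_sub_trans (N := N) (q := q) (σ := σ) (i := i) (j := i) true (by omega)
      simp only [label]
      rw [v1, walk_eq_top, hcc]
      refine ⟨by simp [tc], by push_cast; ring⟩
    · rintro ⟨t', h3, h4⟩
      simp only at h4; omega
    · intro j hj
      rw [← adj_sub_iff i j σ.r, adj_iff (by omega)] at hj
      obtain ⟨-, v2, v3⟩ := val_sub_trans (N := N) (q := q) (σ := σ) (i := i) (j := j) true (by omega)
      have ht : ∀ ε, tc q ε ≤ 2 * q + 4 ∧ 2 * q + 2 ≤ tc q ε := by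
        intro ε; unfold tc; split_ifs <;> omega
      have ht' := ht σ.ε
      have hl : label N p q m σ j = .top (2 * (σ.l - 1 - q) + (j - σ.r).val) := by
        rw [label, walk_eq_top]
        refine ⟨?_, rfl⟩
        unfold Cyc at hj; omega
      rw [hl]
      constructor
      · simp only [label]
        rw [walk_eq_top]
        have : tc q true = 2 * q + 4 := rfl
        unfold Cyc at hj
        rcases hj with hj | hj | hj | hj
        · have := v2 hj (by omega); omega
        · have := v3 hj (by omega); omega
        · omega
        · omega
      · simp only [Passive]
        unfold Cyc at hj
        omega
  | bot y =>
    obtain ⟨t, rfl, h1, h2⟩ := h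
    rw [trans_bot hN hx h1 h2]
    have hx' := hx
    rw [label, walk_eq_bot] at hx'
    have hcc : cc N q m false = m - 1 - N * (q + 1) := rfl
    have htf : tc q false = 2 * q + 2 := rfl
    obtain ⟨d, hd1, hd2, rfl⟩ : ∃ d : ℕ, 1 ≤ d ∧ d ≤ q ∧ t = σ.l - 1 - q + d :=
      ⟨(t - (σ.l - 1 - q)).toNat, by omega, by omega, by omega⟩
    have e4 : (N : ℤ) * (σ.l - 1 - q + d) = N * (σ.l - 1 - q) + ((N * d : ℕ) : ℤ) := by
      push_cast; ring
    have e5 : (N : ℤ) * (σ.l - 1 - q + d) =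
        N * (σ.l - 1 - q + d - 1 - q) + ((N * (q + 1) : ℕ) : ℤ) := by
      push_cast; ring
    have hd3 : N * d ≤ N * q := Nat.mul_le_mul_left _ hd2
    have hd4 : N * 1 ≤ N * d := Nat.mul_le_mul_left _ hd1
    have e6 : N * q = q * N := by ring
    refine ⟨?_, ?_, ?_⟩
    · obtain ⟨v1, -, -⟩ := val_sub_trans (N := N) (q := q) (σ := σ) (i := i) (j := i) false (by omega)
      simp only [label]
      rw [v1, walk_eq_bot, hcc, htf]
      omega
    · rintro ⟨t', h3, h4⟩
      have := mul_left_cancel₀ hN0 h3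
      simp only at h4; omega
    · intro j hj
      rw [← adj_sub_iff i j σ.r, adj_iff (by omega)] at hj
      obtain ⟨-, v2, v3⟩ := val_sub_trans (N := N) (q := q) (σ := σ) (i := i) (j := j) false (by omega)
      have ht : ∀ ε, tc q ε ≤ 2 * q + 4 ∧ 2 * q + 2 ≤ tc q ε := by
        intro ε; unfold tc; split_ifs <;> omega
      have ht' := ht σ.ε
      have hl : label N p q m σ j =
          .bot (N * (σ.l - 1 - q) + (m - 1 - (j - σ.r).val)) := by
        rw [label, walk_eq_bot]
        refine ⟨?_, rfl⟩
        unfold Cyc at hj; omega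
      rw [hl]
      have hj' : (j - σ.r).val = (i - σ.r).val + 1 ∨ (i - σ.r).val = (j - σ.r).val + 1 := by
        unfold Cyc at hj; omega
      constructor
      · simp only [label]
        rw [walk_eq_bot, htf]
        rcases hj' with hj | hj
        · have := v2 hj (by omega); omega
        · have := v3 hj (by omega); omega
      · simp only [Passive]
        have hdvd : (N : ℤ) ∣ N * (σ.l - 1 - q + d) := dvd_mul_right _ _
        intro hdvd'
        have h3 := dvd_sub hdvd hdvd'
        have h4 : ((N : ℤ)) ≤ 1 := by
          rcases hj' with hj | hj
          · have e : (N : ℤ) * (σ.l - 1 - q + d) -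
                (N * (σ.l - 1 - q) + (m - 1 - ((j - σ.r).val : ℤ))) = 1 := by omega
            rw [e] at h3
            exact Int.le_of_dvd one_pos h3
          · have e : (N : ℤ) * (σ.l - 1 - q + d) -
                (N * (σ.l - 1 - q) + (m - 1 - ((j - σ.r).val : ℤ))) = -1 := by omega
            rw [e, dvd_neg] at h3
            exact Int.le_of_dvd one_pos h3
        omega

/-- The machine from the cycle to the ladder graph. -/
def machine [NeZero m] : RAAG.Machine (cycleGraph m) (graph N p) (State m) where
  c := label N p q m
  τ := trans N p q m
  c_inj σ i j h := by
    have := walk_inj h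
    simpa using ZMod.val_injective m this
  adj σ i j h := by
    rw [← adj_sub_iff i j σ.r, adj_iff (by omega)] at h
    exact walk_adj hN hp hm (i - σ.r).val_lt (j - σ.r).val_lt h
  c_self σ i := by
    by_cases h : Active N q σ.l (label N p q m σ i)
    · exact (trans_spec hN hp hm h).1
    · rw [trans_of_not hN h]
  c_adj σ i j hij := by
    by_cases h : Active N q σ.l (label N p q m σ i)
    · exact ((trans_spec hN hp hm h).2.2 j hij).1
    · rw [trans_of_not hN h]
  τ_comm σ := by
    have key : ∀ i j, (cycleGraph m).Adj i j → Active N q σ.l (label N p q m σ i) →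
        trans N p q m i (trans N p q m j σ) = trans N p q m j (trans N p q m i σ) := by
      intro i j hij h
      obtain ⟨h1, h2⟩ := (trans_spec hN hp hm h).2.2 j hij
      have h3 := h2.not_active (q := q) (l := σ.l)
      have h4 := h2.not_active (q := q) (l := (trans N p q m i σ).l)
      rw [← h1] at h4
      rw [trans_of_not hN h3, trans_of_not hN h4]
    intro i j hij
    by_cases hi : Active N q σ.l (label N p q m σ i)
    · exact key i j hij hi
    · by_cases hj : Active N q σ.l (label N p q m σ j)
      · exact (key j i hij.symm hj).symm
      · rw [trans_of_not hN hj, trans_of_not hN hi, trans_of_not hN hj]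
  chordless σ i j hne hij hadj := by
    set σ' := trans N p q m i σ
    have hna : ¬ Active N q σ'.l (label N p q m σ' i) := by
      by_cases h : Active N q σ.l (label N p q m σ i)
      · have := trans_spec hN hp hm h
        rw [this.1]
        exact this.2.1
      · have : σ' = σ := trans_of_not hN h
        rwa [this]
    rw [← adj_sub_iff i j σ'.r, adj_iff (by omega)] at hij
    rcases graph_adj.1 hadj with h | h
    · rcases walk_edge hN hp hm (i - σ'.r).val_lt (j - σ'.r).val_lt h with h | h
      · exact hij h
      · exact hna h.1
    · rcases walk_edge hN hp hm (j - σ'.r).val_lt (i - σ'.r).val_lt h with h | h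
      · exact hij h.symm
      · exact hna h.2

end Machine

end Ladder

/-! ### Tilings and labelled actions -/

/-- A set of tile positions for `A_Γ` whose tiles carry translations in `A_Λ`. -/
structure Tiling {W U : Type*} (Γ : SimpleGraph W) (Λ : SimpleGraph U) (T : Type*) where
  /-- The neighbouring position across a colour. -/
  move : T → W → T
  /-- The translation part of a colour at a position. -/
  μ : T → W → RAAG Λ
  move_move : ∀ x s, move (move x s) s = x
  move_comm : ∀ x s t, Γ.Adj s t → move (move x s) t = move (move x t) s
  μ_move : ∀ x s t, Γ.Adj s t → μ (move x s) t = μ x t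
  μ_comm : ∀ x s t, Γ.Adj s t → Commute (μ x s) (μ x t)
  μ_length : ∀ x s, wordLength (raagGen Λ) (μ x s) ≤ 1

namespace Tiling

variable {W U T : Type*} {Γ : SimpleGraph W} {Λ : SimpleGraph U} (D : Tiling Γ Λ T)

/-- The permutation by which a generator acts. -/
def perm (s : W) : Equiv.Perm (RAAG Λ × T) where
  toFun z := (z.1 * D.μ z.2 s, D.move z.2 s)
  invFun z := (z.1 * (D.μ (D.move z.2 s) s)⁻¹, D.move z.2 s)
  left_inv z := by simp [D.move_move]
  right_inv z := by simp [D.move_move]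

/-- The inverted right action as a homomorphism. -/
def hom : RAAG Γ →* Equiv.Perm (RAAG Λ × T) :=
  RAAG.lift (fun s => (D.perm s)⁻¹) fun s t h => by
    refine Commute.inv_inv ?_
    ext z
    · change z.1 * D.μ z.2 t * D.μ (D.move z.2 t) s = z.1 * D.μ z.2 s * D.μ (D.move z.2 s) t
      rw [D.μ_move _ _ _ h, D.μ_move _ _ _ h.symm, mul_assoc, mul_assoc, (D.μ_comm _ _ _ h).eq]
    · exact D.move_comm _ _ _ h.symm

/-- The right action of the group. -/
def act (z : RAAG Λ × T) (g : RAAG Γ) : RAAG Λ × T := (D.hom g)⁻¹ z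

lemma act_mul (z : RAAG Λ × T) (g h : RAAG Γ) : D.act z (g * h) = D.act (D.act z g) h := by
  simp [act]

@[simp] lemma act_one (z : RAAG Λ × T) : D.act z 1 = z := by simp [act]

lemma act_of (z : RAAG Λ × T) (s : W) :
    D.act z (PresentedGroup.of s) = (z.1 * D.μ z.2 s, D.move z.2 s) := by
  simp only [act, hom, RAAG.lift_of, inv_inv]
  rfl

lemma act_of_inv (z : RAAG Λ × T) (s : W) :
    D.act z (PresentedGroup.of s)⁻¹ = (z.1 * (D.μ (D.move z.2 s) s)⁻¹, D.move z.2 s) := by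
  simp only [act, hom, map_inv, RAAG.lift_of, inv_inv]
  rfl

lemma act_inv_of_act {z z' : RAAG Λ × T} {g : RAAG Γ} (h : D.act z g = z') :
    D.act z' g⁻¹ = z := by
  rw [← h, ← act_mul]; simp

lemma act_conj {a b : RAAG Λ} {x y : T} {g h : RAAG Γ} (hg : ∀ a, D.act (a, x) g = (a, y))
    (hh : D.act (a, y) h = (b, y)) : D.act (a, x) (g * h * g⁻¹) = (b, x) := by
  rw [act_mul, act_mul, hg, hh]
  exact D.act_inv_of_act (hg b)

lemma wordLength_act_le (z : RAAG Λ × T) (g h : RAAG Γ) :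
    wordLength (raagGen Λ) ((D.act z g).1⁻¹ * (D.act z h).1) ≤
      wordLength (raagGen Γ) (g⁻¹ * h) := by
  have := RAAG.le_mul_wordLength Γ (fun g => (D.act z g).1) 1 (fun g a => ?_) g h
  · simpa using this
  · rcases a with ⟨s, _ | _⟩
    · simp only [RAAG.letterVal, act_mul, act_of_inv, inv_mul_cancel_left, Bool.false_eq_true,
        if_false]
      rw [RAAG.wordLength_inv]
      exact D.μ_length _ _
    · simp only [RAAG.letterVal, act_mul, act_of, inv_mul_cancel_left, if_true]
      exact D.μ_length _ _

end Tiling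

/-! ### The tiling acting on the ladder group -/

namespace Ladder

open CycleIndex

/-- Tile positions: the spine and the corner chains. -/
inductive Pos
  | X (t : ℤ)
  | Y (t : ℤ) (ε : Bool) (j : ℕ)

/-- The reflection of relative colours. -/
def flip (N d : ℕ) : ℕ := if d ≤ 4 then 4 - d else N + 8 - d

/-- The parity of a position. -/
def par : Pos → Bool
  | .X t => decide (t % 2 = 1)
  | .Y t _ j => decide ((t + j) % 2 = 1)

/-- The colour relative to a position. -/
def rel {N : ℕ} (x : Pos) (s : ZMod (N + 4)) : ℕ := if par x then (4 - s).val else s.val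

/-- The position across a relative colour. -/
def mv (p : ℕ) : Pos → ℕ → Pos
  | .X t, d => if d = 0 then .Y t false 0 else if d = 1 then .Y t true 0
      else if d = 3 then .Y (t + 1) false 0 else if d = 4 then .Y (t + 1) true 0 else .X t
  | .Y t ε j, d => if p ≤ j then .Y t ε j
      else if j = 0 ∧ d = 0 then (if ε then .X (t - 1) else .X t)
      else if j = 0 ∧ d = 1 then (if ε then .X t else .X (t - 1))
      else if d = 4 ∧ j + 1 < p then .Y t ε (j + 1)
      else if d = 0 then .Y t ε (j - 1) else .Y t ε j

/-- Whether crossing a relative colour changes the parity. -/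
def chg (p : ℕ) : Pos → ℕ → Bool
  | .X _, d => decide (d = 3 ∨ d = 4)
  | .Y _ ε j, d => decide (j < p ∧ ((j = 0 ∧ d = 0 ∧ ε = true) ∨ (j = 0 ∧ d = 1 ∧ ε = false) ∨
      (d = 4 ∧ j + 1 < p) ∨ (d = 0 ∧ 0 < j)))

/-- The relative colour `e` seen after crossing the relative colour `d`. -/
def cross (N p : ℕ) (x : Pos) (d e : ℕ) : ℕ := if chg p x d then flip N e else e

/-- The label of a tile. -/
def lab (N p : ℕ) : Pos → ℕ → Option LV
  | .X t, d => if d = 0 then some (.bot (N * t)) else if d = 1 then some (.top (2 * t))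
      else if d = 2 then some (.top (2 * t + 1)) else if d = 3 then some (.top (2 * t + 2))
      else some (.bot (N * t + (N + 4 - d)))
  | .Y t ε j, d => if p ≤ j then none
      else if d = 0 then (if j = 0 then some (.bot (N * t)) else none)
      else if d = 1 then (if j = 0 then some (.top (2 * t)) else some (.lf t ε (2 * j - 1)))
      else if d = 2 then (if j = 0 then some (.top (2 * t + sgn ε)) else some (.lf t ε (2 * j)))
      else if d = 3 then some (.lf t ε (2 * j + 1))
      else if d = 4 then (if j + 1 = p then some (.lf t ε (2 * p)) else none)
      else if j = 0 ∧ d = N + 3 then some (.bot (N * t - sgn ε))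
      else some (.lf t ε (p * N + 1 - ((N - 2) * j + (N + 3 - d))))

/-- Whether crossing a relative colour is the first half of a translation. -/
def fwd : Pos → ℕ → Bool
  | .X _, d => decide (d = 3 ∨ d = 4)
  | .Y _ ε j, d => decide (j = 0 ∧ ((ε = false ∧ d = 0) ∨ (ε = true ∧ d = 1)))

/-- The translation label of a tile. -/
def tlab (N p : ℕ) (x : Pos) (d : ℕ) : Option LV := if fwd x d then none else lab N p x d

section Pos

variable {N p : ℕ}

lemma par_mv (x : Pos) (d : ℕ) : par (mv p x d) = xor (par x) (chg p x d) := by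
  have key : ∀ a b : ℤ, (b - a) % 2 = 1 → decide (b % 2 = 1) = !decide (a % 2 = 1) := by
    intro a b h
    rw [← decide_not, decide_eq_decide]
    omega
  cases x with
  | X t =>
    simp only [mv, chg]
    split_ifs with h1 h2 h3 h4
    · simp [par, h1]
    · simp [par, h2]
    · simp only [par, h3]; rw [key t]; · simp
      omega
    · simp only [par, h4]; rw [key t]; · simp
      omega
    · simp [h3, h4]
  | Y t ε j =>
    simp only [mv, chg]
    split_ifs with h1 h2 hε h3 hε h4 h5
    · have : ¬ j < p := by omega
      simp [this]
    · obtain ⟨rfl, rfl⟩ := h2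
      have h0 : 0 < p := by omega
      simp only [par]; rw [key t]
      · simp [hε, h0]
      · omega
    · obtain ⟨rfl, rfl⟩ := h2
      simp [par, hε]
    · obtain ⟨rfl, rfl⟩ := h3
      simp [par, hε]
    · obtain ⟨rfl, rfl⟩ := h3
      have h0 : 0 < p := by omega
      simp only [par]; rw [key t]
      · simp [hε, h0]
      · omega
    · obtain ⟨rfl, h4⟩ := h4
      have h0 : j < p := by omega
      simp only [par]; rw [key (t + j)]
      · simp [h4, h0]
      · push_cast; omega
    · subst h5
      simp only [par]; rw [key (t + j)]
      · have h6 : j < p ∧ 0 < j := by omega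
        simp [h6]
      · omega
    · have : ¬ (j < p ∧ ((j = 0 ∧ d = 0 ∧ ε = true) ∨ (j = 0 ∧ d = 1 ∧ ε = false) ∨
          (d = 4 ∧ j + 1 < p) ∨ (d = 0 ∧ 0 < j))) := by
        rintro ⟨-, h | h | h | h⟩
        · exact h2 ⟨h.1, h.2.1⟩
        · exact h3 ⟨h.1, h.2.1⟩
        · exact h4 h
        · exact h5 h.1
      simp [this]

lemma flip_flip {d : ℕ} (hd : d < N + 4) : flip N (flip N d) = d := by
  unfold flip; split_ifs <;> omega

lemma val_four_sub (hN : 3 ≤ N) (s : ZMod (N + 4)) : (4 - s).val = flip N s.val := by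
  have h4 : (4 : ZMod (N + 4)).val = 4 := by
    have := ZMod.val_natCast (N + 4) 4
    rw [Nat.mod_eq_of_lt (by omega)] at this
    exact_mod_cast this
  rw [val_sub_eq, h4, flip]
  split_ifs <;> omega

lemma rel_lt (x : Pos) (s : ZMod (N + 4)) : rel x s < N + 4 := by
  unfold rel; split_ifs <;> exact ZMod.val_lt _

lemma rel_mv (hN : 3 ≤ N) (x : Pos) (d : ℕ) (s : ZMod (N + 4)) :
    rel (mv p x d) s = cross N p x d (rel x s) := by
  have h := s.val_lt
  unfold cross rel
  rw [par_mv, val_four_sub hN]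
  cases par x <;> cases chg p x d <;> simp [flip_flip h]

lemma cyc_rel_iff (x : Pos) (s t : ZMod (N + 4)) :
    Cyc (N + 4) (rel x s) (rel x t) ↔ (cycleGraph (N + 4)).Adj s t := by
  unfold rel
  split_ifs
  · rw [← adj_iff (by omega), adj_sub_left_iff]
  · rw [← adj_iff (by omega)]

/-- The absolute colour of a relative colour. -/
def absc (N : ℕ) (x : Pos) (d : ℕ) : ZMod (N + 4) := if par x then 4 - (d : ZMod (N + 4)) else d

lemma rel_absc {x : Pos} {d : ℕ} (hd : d < N + 4) : rel x (absc N x d) = d := by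
  unfold rel absc
  split_ifs
  · rw [sub_sub_cancel, ZMod.val_natCast, Nat.mod_eq_of_lt hd]
  · rw [ZMod.val_natCast, Nat.mod_eq_of_lt hd]

lemma absc_rel (x : Pos) (s : ZMod (N + 4)) : absc N x (rel x s) = s := by
  unfold rel absc
  split_ifs <;> simp

end Pos

end Ladder

namespace Ladder

open CycleIndex

section Laws

variable {N p : ℕ}

lemma mv_mv (hp : 1 ≤ p) (x : Pos) (d : ℕ) :
    mv p (mv p x d) (cross N p x d d) = x := by
  cases x with
  | X t => grind (splits := 30) [mv, cross, chg, flip]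
  | Y t ε j => cases ε <;> grind (splits := 30) [mv, cross, chg, flip]

lemma mv_comm (hN : 3 ≤ N) (hp : 1 ≤ p) (x : Pos) {d e : ℕ} (hd : d < N + 4) (he : e < N + 4)
    (h : Cyc (N + 4) d e) :
    mv p (mv p x d) (cross N p x d e) = mv p (mv p x e) (cross N p x e d) := by
  unfold Cyc at h
  cases x with
  | X t => grind (splits := 30) [mv, cross, chg, flip]
  | Y t ε j => cases ε <;> grind (splits := 30) [mv, cross, chg, flip]

lemma tlab_mv (hN : 3 ≤ N) (hp : 1 ≤ p) (x : Pos) {d e : ℕ} (he : e < N + 4)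
    (h : Cyc (N + 4) d e) : tlab N p (mv p x d) (cross N p x d e) = tlab N p x e := by
  unfold Cyc at h
  cases x with
  | X t =>
    have h1 : (N : ℤ) * (t + 1) = N * t + N := by ring
    grind (splits := 30) [mv, cross, chg, flip, tlab, fwd, lab, sgn]
  | Y t ε j =>
    have h1 : (N : ℤ) * (t - 1) = N * t - N := by ring
    have h2 : (N - 2) * (j + 1) = (N - 2) * j + (N - 2) := by ring
    have h3 : 1 ≤ j → (N - 2) * j = (N - 2) * (j - 1) + (N - 2) := by
      intro hj
      obtain ⟨i, rfl⟩ := Nat.exists_eq_add_of_le' hj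
      simp [mul_add]
    cases ε <;> grind (splits := 30) [mv, cross, chg, flip, tlab, fwd, lab, sgn]

lemma Edge.top_of_eq {y z : ℤ} (h : z = y + 1) : Edge N p (.top y) (.top z) := h ▸ .top y

lemma Edge.bot_of_eq {y z : ℤ} (h : z = y + 1) : Edge N p (.bot y) (.bot z) := h ▸ .bot y

lemma Edge.rung_of_eq {t y z : ℤ} (hy : y = 2 * t) (hz : z = N * t) :
    Edge N p (.top y) (.bot z) := hy ▸ hz ▸ .rung t

lemma Edge.lf_of_eq {t : ℤ} {ε : Bool} {k l : ℕ} (h : l = k + 1) (hk : 1 ≤ k) (hl : l ≤ p * N) :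
    Edge N p (.lf t ε k) (.lf t ε l) := by
  subst h; exact .lf t ε k hk hl

lemma Edge.first_of_eq {t y : ℤ} {ε : Bool} {k : ℕ} (h : k = 1) (hy : y = 2 * t + sgn ε) :
    Edge N p (.lf t ε k) (.top y) := h ▸ hy ▸ .first t ε

lemma Edge.last_of_eq {t y : ℤ} {ε : Bool} {k : ℕ} (h : k = p * N) (hy : y = N * t - sgn ε) :
    Edge N p (.lf t ε k) (.bot y) := h ▸ hy ▸ .last t ε

lemma chain_bound (hN : 3 ≤ N) {j : ℕ} (hj : j < p) :
    (N - 2) * j + (N - 2) + 2 * p ≤ p * N ∧ (j + 1 = p → (N - 2) * j + (N - 2) + 2 * p = p * N) := by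
  obtain ⟨M, rfl⟩ := Nat.exists_eq_add_of_le' (show 2 ≤ N by omega)
  simp only [Nat.add_sub_cancel]
  constructor
  · nlinarith
  · rintro rfl; ring

lemma lab_adj (hN : 3 ≤ N) (x : Pos) {d e : ℕ} (he : e < N + 4)
    (h : e = d + 1 ∨ d = 0 ∧ e = N + 3) {a b : LV} (ha : lab N p x d = some a)
    (hb : lab N p x e = some b) : Edge N p a b ∨ Edge N p b a := by
  cases x with
  | X t =>
    have hr := Edge.rung (N := N) (p := p) t
    have hr' : ∀ z : ℤ, z = N * t + N → Edge N p (.top (2 * t + 2)) (.bot z) := fun z hz =>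
      Edge.rung_of_eq (t := t + 1) (by ring) (by rw [hz]; ring)
    grind (splits := 30) [lab, Edge.top_of_eq, Edge.bot_of_eq]
  | Y t ε j =>
    have hr := Edge.rung (N := N) (p := p) t
    by_cases hj : j < p
    · obtain ⟨h1, h2⟩ := chain_bound hN hj
      have h3 : j ≠ 0 → N - 2 ≤ (N - 2) * j := fun h0 =>
        Nat.le_mul_of_pos_right _ (Nat.pos_of_ne_zero h0)
      cases ε <;>
      grind (splits := 30) [lab, sgn, Edge.top_of_eq, Edge.bot_of_eq, Edge.lf_of_eq,
        Edge.first_of_eq, Edge.last_of_eq]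
    · grind [lab]

end Laws
end Ladder

namespace Ladder

open CycleIndex

/-- The group element of an optional label. -/
def ofOption (N p : ℕ) : Option LV → RAAG (graph N p)
  | none => 1
  | some v => PresentedGroup.of v

section Tiling

variable {N p : ℕ}

lemma lab_adj_of_cyc (hN : 3 ≤ N) (x : Pos) {d e : ℕ} (hd : d < N + 4) (he : e < N + 4)
    (h : Cyc (N + 4) d e) {a b : LV} (ha : lab N p x d = some a)
    (hb : lab N p x e = some b) : (graph N p).Adj a b := by
  rw [graph_adj]
  rcases h with h | h | h | h
  · exact lab_adj hN x he (by omega) ha hb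
  · exact (lab_adj hN x hd (by omega) hb ha).symm
  · exact lab_adj hN x he (by omega) ha hb
  · exact (lab_adj hN x hd (by omega) hb ha).symm

lemma eq_some_of_tlab {x : Pos} {d : ℕ} {a : LV} (h : tlab N p x d = some a) :
    lab N p x d = some a := by
  unfold tlab at h
  split_ifs at h
  exact h

/-- The tiling by positions. -/
def tiling (hN : 3 ≤ N) (hp : 1 ≤ p) : Tiling (cycleGraph (N + 4)) (graph N p) Pos where
  move x s := mv p x (rel x s)
  μ x s := ofOption N p (tlab N p x (rel x s))
  move_move x s := by rw [rel_mv hN, mv_mv hp]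
  move_comm x s t h := by
    rw [rel_mv hN, rel_mv hN]
    exact mv_comm hN hp x (rel_lt x s) (rel_lt x t) ((cyc_rel_iff x s t).2 h)
  μ_move x s t h := by
    rw [rel_mv hN, tlab_mv hN hp x (rel_lt x t) ((cyc_rel_iff x s t).2 h)]
  μ_comm x s t h := by
    rcases ha : tlab N p x (rel x s) with _ | a
    · exact Commute.one_left _
    · rcases hb : tlab N p x (rel x t) with _ | b
      · exact Commute.one_right _
      · exact RAAG.of_commute _ (lab_adj_of_cyc hN x (rel_lt x s) (rel_lt x t)
          ((cyc_rel_iff x s t).2 h) (eq_some_of_tlab ha) (eq_some_of_tlab hb))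
  μ_length x s := by
    rcases tlab N p x (rel x s) with _ | a
    · exact (RAAG.wordLength_one _).trans_le zero_le_one
    · exact RAAG.wordLength_of_le _ _

/-- The generator of the cycle group of a colour. -/
def gen (N : ℕ) (c : ZMod (N + 4)) : RAAG (cycleGraph (N + 4)) := PresentedGroup.of c

lemma act_gen (hN : 3 ≤ N) (hp : 1 ≤ p) (a : RAAG (graph N p)) (x : Pos) {d : ℕ}
    (hd : d < N + 4) : (tiling hN hp).act (a, x) (gen N (absc N x d)) =
      (a * ofOption N p (tlab N p x d), mv p x d) := by
  rw [gen, Tiling.act_of]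
  change (a * ofOption N p (tlab N p x (rel x (absc N x d))), mv p x (rel x (absc N x d))) = _
  rw [rel_absc hd]

lemma absc_mv (hN : 3 ≤ N) (x : Pos) (d : ℕ) {e : ℕ} (he : e < N + 4) :
    absc N (mv p x d) (cross N p x d e) = absc N x e := by
  have := rel_mv (p := p) hN x d (absc N x e)
  rw [rel_absc he] at this
  rw [← this, absc_rel]

lemma gen_commute (x : Pos) {d e : ℕ} (hd : d < N + 4) (he : e < N + 4)
    (h : Cyc (N + 4) d e) : Commute (gen N (absc N x d)) (gen N (absc N x e)) := by
  refine RAAG.of_commute _ ((cyc_rel_iff x _ _).1 ?_)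
  rwa [rel_absc hd, rel_absc he]

/-! ### Base points of the positions -/

/-- The two generators between consecutive spine positions. -/
def link (N : ℕ) (t : ℤ) : RAAG (cycleGraph (N + 4)) :=
  gen N (absc N (.X t) 0) * gen N (absc N (.X t) 1)

/-- The base point of a spine position. -/
def spine (N : ℕ) (t : ℤ) : RAAG (cycleGraph (N + 4)) :=
  (link N 1 * link N 0) ^ (t / 2) * if t % 2 = 1 then link N 1 else 1

/-- The base point of a chain position. -/
def branch (N : ℕ) (t : ℤ) (ε : Bool) : ℕ → RAAG (cycleGraph (N + 4))
  | 0 => spine N (t - 1) * gen N (absc N (.X t) (if ε then 0 else 1))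
  | j + 1 => branch N t ε j * gen N (absc N (.Y t ε j) 4)

/-- The base point of a position. -/
def base (N : ℕ) : Pos → RAAG (cycleGraph (N + 4))
  | .X t => spine N t
  | .Y t ε j => branch N t ε j

lemma absc_of_par {x y : Pos} (h : par x = par y) (d : ℕ) : absc N x d = absc N y d := by
  unfold absc; rw [h]

lemma link_congr {s t : ℤ} (h : s % 2 = t % 2) : link N s = link N t := by
  have : par (.X s) = par (.X t) := by simp [par, h]
  simp only [link, absc_of_par this]

lemma spine_add_one (t : ℤ) : spine N (t + 1) = spine N t * link N (t + 1) := by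
  unfold spine
  rcases Int.emod_two_eq_zero_or_one t with h | h
  · have h1 : (t + 1) / 2 = t / 2 := by omega
    have h2 : (t + 1) % 2 = 1 := by omega
    rw [h1, if_pos h2, if_neg (by omega), mul_one, link_congr (s := t + 1) (t := 1) (by omega)]
  · have h1 : (t + 1) / 2 = t / 2 + 1 := by omega
    rw [h1, if_neg (by omega), if_pos h, mul_one, link_congr (s := t + 1) (t := 0) (by omega),
      zpow_add_one, mul_assoc]

lemma spine_sub_one (t : ℤ) : spine N t = spine N (t - 1) * link N t := by
  simpa using spine_add_one (N := N) (t - 1)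

lemma absc_three (t : ℤ) : absc N (.X t) 3 = absc N (.X (t + 1)) 1 := by
  rcases Int.emod_two_eq_zero_or_one t with h | h
  · have : (t + 1) % 2 = 1 := by omega
    simp [absc, par, h, this]; ring
  · have : (t + 1) % 2 = 0 := by omega
    simp [absc, par, h, this]; ring

lemma absc_four (t : ℤ) : absc N (.X t) 4 = absc N (.X (t + 1)) 0 := by
  rcases Int.emod_two_eq_zero_or_one t with h | h
  · have : (t + 1) % 2 = 1 := by omega
    simp [absc, par, h, this]
  · have : (t + 1) % 2 = 0 := by omega
    simp [absc, par, h, this]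

lemma absc_Y_zero (t : ℤ) (ε : Bool) (d : ℕ) : absc N (.Y t ε 0) d = absc N (.X t) d :=
  absc_of_par (by simp [par]) d

lemma link_comm (t : ℤ) :
    link N t = gen N (absc N (.X t) 1) * gen N (absc N (.X t) 0) :=
  gen_commute _ (by omega) (by omega) (.inl rfl)

/-- Crossing a tile either stays, or is a step between base points in one of the directions. -/
lemma base_mv (hN : 3 ≤ N) (x : Pos) (d : ℕ) : mv p x d = x ∨
    base N (mv p x d) = base N x * gen N (absc N x d) ∨
    base N x = base N (mv p x d) * gen N (absc N x d) := by
  cases x with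
  | X t =>
    by_cases h0 : d = 0
    · subst h0
      right; right
      simp only [mv, base, branch, if_true, Bool.false_eq_true, if_false, mul_assoc]
      rw [spine_sub_one, link_comm]
    by_cases h1 : d = 1
    · subst h1
      right; right
      simp only [mv, base, branch, one_ne_zero, if_true, if_false, mul_assoc]
      rw [spine_sub_one, link]
    by_cases h3 : d = 3
    · subst h3
      right; left
      simp [mv, base, branch, absc_three]
    by_cases h4 : d = 4
    · subst h4
      right; left
      simp [mv, base, branch, absc_four]
    left
    simp [mv, h0, h1, h3, h4]
  | Y t ε j =>
    simp only [mv]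
    split_ifs with h1 h2 hε h3 hε h4 h5
    · exact .inl rfl
    · obtain ⟨rfl, rfl⟩ := h2
      right; right
      simp [base, branch, hε, absc_Y_zero]
    · obtain ⟨rfl, rfl⟩ := h2
      right; left
      simp only [base, branch, hε, absc_Y_zero, Bool.false_eq_true, if_false, mul_assoc]
      rw [spine_sub_one, link_comm]
    · obtain ⟨rfl, rfl⟩ := h3
      right; left
      simp only [base, branch, hε, absc_Y_zero, if_true, mul_assoc]
      rw [spine_sub_one, link]
    · obtain ⟨rfl, rfl⟩ := h3
      right; right
      simp [base, branch, hε, absc_Y_zero]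
    · right; left
      simp [base, branch, h4.1]
    · right; right
      subst h5
      obtain ⟨i, rfl⟩ := Nat.exists_eq_add_of_le' (show 1 ≤ j by omega)
      simp only [base, branch, Nat.add_sub_cancel]
      congr 2
      have := absc_mv (p := p) hN (.Y t ε (i + 1)) 0 (e := 0) (by omega)
      have h0 : i + 1 < p := by omega
      simp [mv, cross, chg, flip, h0, show ¬ p ≤ i + 1 by omega] at this
      exact this
    · exact .inl rfl

lemma act_link (hN : 3 ≤ N) (hp : 1 ≤ p) (a : RAAG (graph N p)) (t : ℤ) :
    (tiling hN hp).act (a, .X (t - 1)) (gen N (absc N (.X t) 1)) = (a, .Y t false 0) ∧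
    (tiling hN hp).act (a, .X (t - 1)) (gen N (absc N (.X t) 0)) = (a, .Y t true 0) ∧
    (tiling hN hp).act (a, .X (t - 1)) (link N t) = (a, .X t) := by
  have h3 := act_gen hN hp a (.X (t - 1)) (d := 3) (by omega)
  have h4 := act_gen hN hp a (.X (t - 1)) (d := 4) (by omega)
  have h0 := act_gen hN hp a (.Y t true 0) (d := 1) (by omega)
  simp only [absc_three, absc_four, absc_Y_zero, sub_add_cancel] at h3 h4 h0
  have e3 : (tiling hN hp).act (a, .X (t - 1)) (gen N (absc N (.X t) 1)) = (a, .Y t false 0) := by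
    simpa [tlab, fwd, ofOption, mv] using h3
  have e4 : (tiling hN hp).act (a, .X (t - 1)) (gen N (absc N (.X t) 0)) = (a, .Y t true 0) := by
    simpa [tlab, fwd, ofOption, mv] using h4
  refine ⟨e3, e4, ?_⟩
  rw [link, Tiling.act_mul, e4, h0]
  simp [tlab, fwd, ofOption, mv, show p ≠ 0 by omega]

lemma act_spine (hN : 3 ≤ N) (hp : 1 ≤ p) (a : RAAG (graph N p)) (t : ℤ) :
    (tiling hN hp).act (a, .X 0) (spine N t) = (a, .X t) := by
  induction t with
  | zero => simp [spine]
  | succ t ih =>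
    have := (act_link hN hp a (t + 1)).2.2
    rw [add_sub_cancel_right] at this
    rw [spine_add_one, Tiling.act_mul, ih, this]
  | pred t ih =>
    have := Tiling.act_inv_of_act _ (act_link hN hp a (-t)).2.2
    rw [spine_sub_one] at ih
    rw [← this, ← ih, ← Tiling.act_mul, mul_inv_cancel_right]

lemma act_branch (hN : 3 ≤ N) (hp : 1 ≤ p) (a : RAAG (graph N p)) (t : ℤ) (ε : Bool) (j : ℕ)
    (hj : j < p) : (tiling hN hp).act (a, .X 0) (branch N t ε j) = (a, .Y t ε j) := by
  induction j with
  | zero =>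
    rw [branch, Tiling.act_mul, act_spine]
    cases ε
    · simpa using (act_link hN hp a t).1
    · simpa using (act_link hN hp a t).2.1
  | succ j ih =>
    rw [branch, Tiling.act_mul, ih (by omega), act_gen hN hp _ _ (by omega)]
    simp [tlab, fwd, ofOption, mv, lab, hj, hj.ne, show ¬ p ≤ j by omega]

lemma act_base (hN : 3 ≤ N) (hp : 1 ≤ p) (a : RAAG (graph N p)) {x : Pos} {d : ℕ} {v : LV}
    (h : lab N p x d = some v) : (tiling hN hp).act (a, .X 0) (base N x) = (a, x) := by
  cases x with
  | X t => exact act_spine hN hp a t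
  | Y t ε j =>
    refine act_branch hN hp a t ε j ?_
    by_contra hj
    simp [lab, not_lt.1 hj] at h

end Tiling

end Ladder

namespace Ladder

open CycleIndex

section Rep

variable {N p : ℕ}

/-- The conjugate of a generator attached to a tile. -/
def conj (N : ℕ) (x : Pos) (d : ℕ) : RAAG (cycleGraph (N + 4)) :=
  base N x * gen N (absc N x d) * (base N x)⁻¹

lemma conj_commute (x : Pos) {d e : ℕ} (hd : d < N + 4) (he : e < N + 4)
    (h : Cyc (N + 4) d e) : Commute (conj N x d) (conj N x e) :=
  (Commute.conj_iff _).2 (gen_commute x hd he h)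

lemma conj_mv (hN : 3 ≤ N) (x : Pos) {d e : ℕ} (hd : d < N + 4) (he : e < N + 4)
    (h : Cyc (N + 4) d e ∨ d = e) : conj N (mv p x d) (cross N p x d e) = conj N x e := by
  have hc : Commute (gen N (absc N x d)) (gen N (absc N x e)) := by
    rcases h with h | rfl
    · exact gen_commute x hd he h
    · exact Commute.refl _
  have hc' := hc.mul_inv_cancel
  unfold conj
  rw [absc_mv hN x d he]
  rcases base_mv (p := p) hN x d with h | h | h
  · rw [h]
  · conv_rhs => rw [← hc']
    rw [h]; group
  · conv_lhs => rw [← hc']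
    rw [h]; group

/-- A tile carrying a given label. -/
def rep (N p : ℕ) : LV → Pos × ℕ
  | .top y => (.X (y / 2), if y % 2 = 0 then 1 else 2)
  | .bot y => (.X (y / N), if y % N = 0 then 0 else (N + 4 - y % N).toNat)
  | .lf t ε k => if k < 2 * p then (.Y t ε (k / 2), if k % 2 = 1 then 3 else 2)
      else if k = 2 * p then (.Y t ε (p - 1), 4)
      else (.Y t ε ((p * N - k) / (N - 2)), N + 2 - (p * N - k) % (N - 2))

/-- The conjugate attached to a label. -/
def repConj (N p : ℕ) (v : LV) : RAAG (cycleGraph (N + 4)) := conj N (rep N p v).1 (rep N p v).2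

lemma rep_bot (hN : 3 ≤ N) (t : ℤ) (r : ℤ) (h0 : 0 ≤ r) (hr : r < N) :
    rep N p (.bot (N * t + r)) = (.X t, if r = 0 then 0 else (N + 4 - r).toNat) := by
  have h1 : (N * t + r) / N = t := by
    rw [add_comm, Int.add_mul_ediv_left _ _ (by omega), Int.ediv_eq_zero_of_lt h0 hr, zero_add]
  have h2 : (N * t + r) % N = r := by
    rw [add_comm, Int.add_mul_emod_self_left, Int.emod_eq_of_lt h0 hr]
  simp only [rep, h1, h2]

lemma rep_lf (hN : 3 ≤ N) (t : ℤ) (ε : Bool) (j r : ℕ) (hj : j < p) (hr : r < N - 2) :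
    rep N p (.lf t ε (p * N - ((N - 2) * j + r))) = (.Y t ε j, N + 2 - r) := by
  obtain ⟨h1, -⟩ := chain_bound hN hj
  have h2 : p * N - (p * N - ((N - 2) * j + r)) = (N - 2) * j + r := by omega
  have h3 : ((N - 2) * j + r) / (N - 2) = j := by
    rw [add_comm, Nat.add_mul_div_left _ _ (by omega), Nat.div_eq_of_lt hr, zero_add]
  have h4 : ((N - 2) * j + r) % (N - 2) = r := by
    rw [add_comm, Nat.add_mul_mod_self_left, Nat.mod_eq_of_lt hr]
  simp only [rep]
  rw [if_neg (by omega), if_neg (by omega), h2, h3, h4]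

/-- Tiles with the same label carry the same conjugate. -/
lemma conj_eq_repConj (hN : 3 ≤ N) (hp : 1 ≤ p) (x : Pos) {d : ℕ} (hd : d < N + 4) {v : LV}
    (h : lab N p x d = some v) : conj N x d = repConj N p v := by
  have key {y z : Pos} {e f f' : ℕ} (he : e < N + 4) (hf : f < N + 4)
      (h : Cyc (N + 4) e f ∨ e = f) (h1 : mv p y e = z) (h2 : cross N p y e f = f') :
      conj N y f = conj N z f' := by
    rw [← h1, ← h2, conj_mv hN y he hf h]
  have hp0 : 0 < p := hp
  have hp1 : p ≠ 0 := by omega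
  have hbot0 (t : ℤ) : rep N p (.bot (N * t)) = (.X t, 0) := by
    simpa using rep_bot (p := p) hN t 0 le_rfl (by omega)
  have htop0 (t : ℤ) : rep N p (.top (2 * t)) = (.X t, 1) := by simp [rep]
  have htop1 (t : ℤ) : rep N p (.top (2 * t + 1)) = (.X t, 2) := by
    have e1 : (2 * t + 1) / 2 = t := by omega
    have e2 : (2 * t + 1) % 2 = 1 := by omega
    simp [rep, e1, e2]
  unfold repConj
  cases x with
  | X t =>
    simp only [lab] at h
    split_ifs at h with h0 h1 h2 h3 <;> obtain rfl := Option.some.inj h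
    · rw [h0, hbot0]
    · rw [h1, htop0]
    · rw [h2, htop1]
    · rw [h3, show 2 * t + 2 = 2 * (t + 1) by ring, htop0]
      refine (key (e := 3) (f := 3) (z := .Y (t + 1) false 0) (f' := 1) (by omega) (by omega)
        (.inr rfl) ?_ ?_).trans
        (key (e := 0) (f := 1) (by omega) (by omega) (.inl (.inl rfl)) ?_ ?_) <;>
      simp [mv, cross, chg, flip, hp1]
    · by_cases h4 : d = 4
      · rw [h4, show (N * t + (N + 4 - (4 : ℕ)) : ℤ) = N * (t + 1) by push_cast; ring, hbot0]
        refine (key (e := 4) (f := 4) (z := .Y (t + 1) true 0) (f' := 0) (by omega) (by omega)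
          (.inr rfl) ?_ ?_).trans
          (key (e := 1) (f := 0) (by omega) (by omega) (.inl (.inr (.inl rfl))) ?_ ?_) <;>
        simp [mv, cross, chg, flip, hp1]
      · have := rep_bot (p := p) hN t (N + 4 - d) (by omega) (by omega)
        rw [this, if_neg (by omega)]
        congr 1
        omega
  | Y t ε j =>
    have hj : j < p := by
      by_contra hj
      simp [lab, not_lt.1 hj] at h
    have hj' : ¬ p ≤ j := not_le.2 hj
    obtain ⟨hb, hb'⟩ := chain_bound hN hj
    simp only [lab] at h
    split_ifs at h with h1 h2 h2 h3 h2 h3 h2 h2 h2 h2 <;> obtain rfl := Option.some.inj h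
    · subst h1 h2
      rw [hbot0]
      cases ε
      · refine key (e := 0) (by omega) (by omega) (.inr rfl) ?_ ?_ <;>
        simp [mv, cross, chg, hp1]
      · refine key (e := 1) (by omega) (by omega) (.inl (.inr (.inl rfl))) ?_ ?_ <;>
        simp [mv, cross, chg, hp1]
    · subst h2 h3
      rw [htop0]
      cases ε
      · refine key (e := 0) (by omega) (by omega) (.inl (.inl rfl)) ?_ ?_ <;>
        simp [mv, cross, chg, hp1]
      · refine key (e := 1) (by omega) (by omega) (.inr rfl) ?_ ?_ <;>
        simp [mv, cross, chg, hp1]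
    · subst h2
      obtain ⟨i, rfl⟩ := Nat.exists_eq_add_of_le' (show 1 ≤ j by omega)
      have e0 : 2 * (i + 1) - 1 = 2 * i + 1 := by omega
      have e1 : 2 * i + 1 < 2 * p := by omega
      have e2 : (2 * i + 1) / 2 = i := by omega
      have e3 : (2 * i + 1) % 2 = 1 := by omega
      simp only [rep, e0, if_pos e1, e2, if_pos e3]
      refine key (e := 0) (by omega) (by omega) (.inl (.inl rfl)) ?_ ?_ <;>
      simp [mv, cross, chg, flip, hj, hj']
    · subst h2 h3
      cases ε
      · rw [show 2 * t + sgn false = 2 * (t - 1) + 1 by simp [sgn]; ring, htop1]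
        refine key (e := 1) (by omega) (by omega) (.inl (.inl rfl)) ?_ ?_ <;>
        simp [mv, cross, chg, flip, hp1, hp0]
      · rw [show 2 * t + sgn true = 2 * t + 1 by simp [sgn], htop1]
        refine key (e := 1) (by omega) (by omega) (.inl (.inl rfl)) ?_ ?_ <;>
        simp [mv, cross, chg, hp1]
    · subst h2
      have e1 : 2 * j < 2 * p := by omega
      have e2 : 2 * j / 2 = j := by omega
      have e3 : ¬ 2 * j % 2 = 1 := by omega
      simp only [rep, if_pos e1, e2, if_neg e3]
    · subst h2
      have e1 : 2 * j + 1 < 2 * p := by omega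
      have e2 : (2 * j + 1) / 2 = j := by omega
      have e3 : (2 * j + 1) % 2 = 1 := by omega
      simp only [rep, if_pos e1, e2, if_pos e3]
    · subst h2
      simp [rep, h2]
    · obtain ⟨rfl, rfl⟩ := h2
      cases ε
      · rw [show N * t - sgn false = N * t + 1 by simp [sgn], rep_bot hN t 1 (by omega) (by omega)]
        refine key (e := 0) (by omega) (by omega) (.inl (.inr (.inr (.inl ⟨rfl, rfl⟩)))) ?_ ?_
        · simp [mv, hp1]
        · simp [cross, chg]; omega
      · rw [show N * t - sgn true = N * (t - 1) + (N - 1) by simp [sgn]; ring,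
          rep_bot hN (t - 1) (N - 1) (by omega) (by omega), if_neg (by omega)]
        refine key (e := 0) (by omega) (by omega) (.inl (.inr (.inr (.inl ⟨rfl, rfl⟩)))) ?_ ?_
        · simp [mv, hp1]
        · simp [cross, chg, flip, hp0]; omega
    · by_cases h6 : d = N + 3
      · obtain ⟨i, rfl⟩ := Nat.exists_eq_add_of_le' (show 1 ≤ j by omega)
        have e1 : p * N + 1 - ((N - 2) * (i + 1) + (N + 3 - d)) =
            p * N - ((N - 2) * i + (N - 3)) := by
          rw [mul_add] at *
          omega
        rw [e1, rep_lf hN t ε i (N - 3) (by omega) (by omega), h6]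
        refine key (e := 0) (by omega) (by omega) (.inl (.inr (.inr (.inl ⟨rfl, rfl⟩)))) ?_ ?_
        · simp [mv, hj']
        · simp [cross, chg, flip, hj]; split_ifs <;> omega
      · have e1 : p * N + 1 - ((N - 2) * j + (N + 3 - d)) =
            p * N - ((N - 2) * j + (N + 2 - d)) := by omega
        rw [e1, rep_lf hN t ε j (N + 2 - d) hj (by omega)]
        congr 1
        omega

end Rep

end Ladder

namespace Ladder

open CycleIndex

section Psi

variable {N p : ℕ}

/-- Every edge of the ladder graph is seen by two adjacent tiles. -/
lemma Edge.exists_tile (hN : 3 ≤ N) (hp : 1 ≤ p) {v w : LV} (h : Edge N p v w) :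
    ∃ x d e, d < N + 4 ∧ e < N + 4 ∧ Cyc (N + 4) d e ∧ lab N p x d = some v ∧
      lab N p x e = some w := by
  have hp0 : p ≠ 0 := by omega
  cases h with
  | top y =>
    rcases Int.emod_two_eq_zero_or_one y with hy | hy
    · refine ⟨.X (y / 2), 1, 2, by omega, by omega, .inl rfl, ?_, ?_⟩ <;> simp [lab] <;> omega
    · refine ⟨.X (y / 2), 2, 3, by omega, by omega, .inl rfl, ?_, ?_⟩ <;> simp [lab] <;> omega
  | bot y =>
    obtain ⟨k, hk⟩ : ∃ k : ℕ, y % N = k :=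
      ⟨(y % N).toNat, (Int.toNat_of_nonneg (Int.emod_nonneg _ (by omega))).symm⟩
    have hk' : y % N < N := Int.emod_lt_of_pos _ (by omega)
    have hy := Int.mul_ediv_add_emod y N
    by_cases h0 : k = 0
    · refine ⟨.X (y / N), 0, N + 3, by omega, by omega, .inr (.inr (.inl ⟨rfl, rfl⟩)), ?_, ?_⟩
      · simp [lab]; omega
      · grind [lab]
    · refine ⟨.X (y / N), N + 4 - k, N + 3 - k, by omega, by omega, .inr (.inl (by omega)), ?_, ?_⟩
        <;> grind [lab]
  | rung t => exact ⟨.X t, 1, 0, by omega, by omega, .inr (.inl rfl), by simp [lab], by simp [lab]⟩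
  | lf t ε k hk hk' =>
    by_cases h1 : k < 2 * p
    · by_cases h2 : k % 2 = 0
      · refine ⟨.Y t ε (k / 2), 2, 3, by omega, by omega, .inl rfl, ?_, ?_⟩ <;> grind [lab]
      · by_cases h3 : k + 1 = 2 * p
        · refine ⟨.Y t ε (p - 1), 3, 4, by omega, by omega, .inl rfl, ?_, ?_⟩ <;> grind [lab]
        · refine ⟨.Y t ε (k / 2 + 1), 1, 2, by omega, by omega, .inl rfl, ?_, ?_⟩ <;> grind [lab]
    · by_cases h2 : k = 2 * p
      · have := (chain_bound hN (show p - 1 < p by omega)).2 (by omega)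
        refine ⟨.Y t ε (p - 1), 4, 5, by omega, by omega, .inl rfl, ?_, ?_⟩ <;> grind [lab]
      · obtain ⟨i, hi⟩ : ∃ i, i = p * N - k := ⟨_, rfl⟩
        have hd := Nat.div_add_mod i (N - 2)
        have hr := Nat.mod_lt i (show 0 < N - 2 by omega)
        have hj : i / (N - 2) < p := by
          rw [Nat.div_lt_iff_lt_mul (by omega)]
          have := (chain_bound hN (show p - 1 < p by omega)).2 (by omega)
          have : p * (N - 2) = (N - 2) * (p - 1) + (N - 2) := by
            obtain ⟨s, rfl⟩ := Nat.exists_eq_add_of_le' hp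
            simp; ring
          omega
        refine ⟨.Y t ε (i / (N - 2)), N + 2 - i % (N - 2), N + 3 - i % (N - 2), by omega, by omega,
          .inl (by omega), ?_, ?_⟩ <;> grind [lab]
  | first t ε => exact ⟨.Y t ε 0, 3, 2, by omega, by omega, .inr (.inl rfl), by simp [lab, hp0],
      by simp [lab, hp0]⟩
  | last t ε =>
    refine ⟨.Y t ε 0, N + 2, N + 3, by omega, by omega, .inl rfl, ?_, ?_⟩ <;> grind [lab]

lemma InRange.exists_tile (hN : 3 ≤ N) (hp : 1 ≤ p) {v : LV} (h : InRange N p v) :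
    ∃ x d, d < N + 4 ∧ lab N p x d = some v := by
  suffices ∃ w, Edge N p v w ∨ Edge N p w v by
    obtain ⟨w, h | h⟩ := this <;> obtain ⟨x, d, e, hd, he, -, h1, h2⟩ := h.exists_tile hN hp
    exacts [⟨x, d, hd, h1⟩, ⟨x, e, he, h2⟩]
  cases v with
  | top y => exact ⟨_, .inl (.top y)⟩
  | bot y => exact ⟨_, .inl (.bot y)⟩
  | lf t ε k =>
    by_cases hk : k = 1
    · exact ⟨_, .inl (Edge.first_of_eq hk rfl)⟩
    · have h1 := h.1
      have h2 := h.2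
      exact ⟨_, .inr (Edge.lf_of_eq (k := k - 1) (by omega) (by omega) h2)⟩

/-- The exponent attached to a label. -/
def mult (N : ℕ) : LV → ℕ
  | .top y => if y % 2 = 0 then 2 else 1
  | .bot y => if y % N = 0 then 2 else 1
  | .lf _ _ _ => 1

lemma mult_cases (hN : 3 ≤ N) (hp : 1 ≤ p) (x : Pos) {d : ℕ} (hd : d < N + 4) {v : LV}
    (h : lab N p x d = some v) : (mult N v = 1 ∧ mv p x d = x ∧ fwd x d = false) ∨
      (mult N v = 2 ∧ fwd x d = false ∧ fwd (mv p x d) (cross N p x d d) = true) ∨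
      (mult N v = 2 ∧ fwd x d = true ∧ fwd (mv p x d) (cross N p x d d) = false ∧
        lab N p (mv p x d) (cross N p x d d) = some v) := by
  have hr (t r : ℤ) (h0 : 0 < r) (h1 : r < N) : ¬ (N * t + r) % N = 0 := by
    rw [add_comm, Int.add_mul_emod_self_left, Int.emod_eq_of_lt h0.le h1]
    exact h0.ne'
  have hz (t : ℤ) : (N * t) % N = 0 := Int.mul_emod_right _ _
  cases x with
  | X t =>
    have h1 := hz t
    have h2 : d = 4 → (N * t + (N + 4 - d) : ℤ) % N = 0 := by
      rintro rfl
      rw [show (N * t + (N + 4 - (4 : ℕ)) : ℤ) = N * (t + 1) by push_cast; ring, hz]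
    have h3 : 4 < d → ¬ (N * t + (N + 4 - d) : ℤ) % N = 0 :=
      fun h4 => hr t (N + 4 - d) (by omega) (by omega)
    have h4 : (N * t + (N + 4 - (4 : ℕ)) : ℤ) = N * (t + 1) := by push_cast; ring
    clear hr hz
    by_cases h5 : d = 4
    · have h2' := h2 h5
      subst h5
      rw [h4] at h2'
      simp only [lab, h4] at h
      obtain rfl := Option.some.inj h
      right; right
      simp [mv, cross, chg, flip, fwd, mult, lab, show p ≠ 0 by omega, h2']
    grind (splits := 30) [lab, mv, cross, chg, flip, fwd, mult]
  | Y t ε j =>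
    have h1 := hz t
    have h2 := hr t 1 (by omega) (by omega)
    have h3 : ¬ (N * t - 1) % N = 0 := by
      have := hr (t - 1) (N - 1) (by omega) (by omega)
      rwa [show N * (t - 1) + (N - 1 : ℤ) = N * t - 1 by ring] at this
    clear hr hz
    cases ε <;> grind (splits := 30) [lab, mv, cross, chg, flip, fwd, mult, sgn]

lemma act_gen_pow (hN : 3 ≤ N) (hp : 1 ≤ p) (a : RAAG (graph N p)) {x : Pos} {d : ℕ}
    (hd : d < N + 4) {v : LV} (h : lab N p x d = some v) :
    (tiling hN hp).act (a, x) (gen N (absc N x d) ^ mult N v) = (a * PresentedGroup.of v, x) := by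
  have hmv := mv_mv hp x d (N := N)
  have hlt : cross N p x d d < N + 4 := by
    have := rel_lt (N := N) (mv p x d) (absc N x d)
    rwa [rel_mv hN, rel_absc hd] at this
  have h1 := fun a => act_gen hN hp a x hd
  have h2 := fun a => act_gen hN hp a (mv p x d) hlt
  rw [absc_mv hN x d hd, hmv] at h2
  rcases mult_cases hN hp x hd h with ⟨h3, h4, h5⟩ | ⟨h3, h4, h5⟩ | ⟨h3, h4, h5, h6⟩
  · rw [h3, pow_one, h1, h4]
    simp [tlab, h5, h, ofOption]
  · rw [h3, pow_two, Tiling.act_mul, h1, h2]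
    simp [tlab, h4, h5, h, ofOption]
  · rw [h3, pow_two, Tiling.act_mul, h1, h2]
    simp [tlab, h4, h5, h6, ofOption]

/-- The homomorphism from the ladder group to the cycle group. -/
def psi (hN : 3 ≤ N) (hp : 1 ≤ p) : RAAG (graph N p) →* RAAG (cycleGraph (N + 4)) :=
  RAAG.lift (fun v => repConj N p v ^ mult N v) fun v w h => by
    have key : ∀ v w, Edge N p v w → Commute (repConj N p v) (repConj N p w) := by
      intro v w h
      obtain ⟨x, d, e, hd, he, hc, hv, hw⟩ := h.exists_tile hN hp
      rw [← conj_eq_repConj hN hp x hd hv, ← conj_eq_repConj hN hp x he hw]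
      exact conj_commute x hd he hc
    rcases graph_adj.1 h with h | h
    · exact (key v w h).pow_pow _ _
    · exact ((key w v h).symm).pow_pow _ _

lemma psi_of (hN : 3 ≤ N) (hp : 1 ≤ p) {x : Pos} {d : ℕ} (hd : d < N + 4) {v : LV}
    (h : lab N p x d = some v) : psi hN hp (PresentedGroup.of v) =
      base N x * gen N (absc N x d) ^ mult N v * (base N x)⁻¹ := by
  rw [psi, RAAG.lift_of, ← conj_eq_repConj hN hp x hd h, conj, conj_pow]

lemma act_psi (hN : 3 ≤ N) (hp : 1 ≤ p) (a : RAAG (graph N p)) {v : LV} (h : InRange N p v) :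
    (tiling hN hp).act (a, .X 0) (psi hN hp (PresentedGroup.of v)) =
      (a * PresentedGroup.of v, .X 0) := by
  obtain ⟨x, d, hd, hv⟩ := h.exists_tile hN hp
  rw [psi_of hN hp hd hv]
  exact Tiling.act_conj _ (fun a => act_base hN hp a hv) (act_gen_pow hN hp a hd hv)

lemma act_psi_val (hN : 3 ≤ N) (hp : 1 ≤ p) (a : RAAG (graph N p)) {w : List (LV × Bool)}
    (h : ∀ b ∈ w, InRange N p b.1) :
    (tiling hN hp).act (a, .X 0) (psi hN hp (RAAG.val _ w)) = (a * RAAG.val _ w, .X 0) := by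
  induction w with
  | nil => simp
  | cons b w ih =>
    simp only [List.mem_cons, forall_eq_or_imp] at h
    rw [RAAG.val_cons, map_mul, Tiling.act_mul, ih h.2, ← mul_assoc]
    rcases b with ⟨v, _ | _⟩
    · simp only [RAAG.letterVal, map_inv, Bool.false_eq_true, if_false]
      refine Tiling.act_inv_of_act _ ?_
      rw [act_psi hN hp _ h.1, inv_mul_cancel_right]
    · simp only [RAAG.letterVal, if_true]
      exact act_psi hN hp _ h.1

end Psi

end Ladder

namespace Ladder

open CycleIndex

section Estimates

variable {N p q m : ℕ}

local notation "‖" g "‖ₙ" => wordLength (raagGen (cycleGraph (N + 4))) g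

lemma wordLength_spine (s t : ℤ) : ‖(spine N s)⁻¹ * spine N t‖ₙ ≤ 2 * (t - s).natAbs := by
  have key : ∀ (k : ℕ) (s : ℤ), ‖(spine N s)⁻¹ * spine N (s + k)‖ₙ ≤ 2 * k := by
    intro k s
    induction k with
    | zero => simp [RAAG.wordLength_one]
    | succ k ih =>
      have e : s + ((k + 1 : ℕ) : ℤ) = s + k + 1 := by push_cast; ring
      rw [e, spine_add_one, ← mul_assoc]
      refine (RAAG.wordLength_mul_le _ _ _).trans ?_
      have h : ‖link N (s + k + 1)‖ₙ ≤ 2 :=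
        (RAAG.wordLength_mul_le _ _ _).trans
          (Nat.add_le_add (RAAG.wordLength_of_le _ _) (RAAG.wordLength_of_le _ _))
      omega
  rcases le_total s t with h | h
  · have := key (t - s).natAbs s
    rwa [show s + ((t - s).natAbs : ℤ) = t by omega] at this
  · have := key (t - s).natAbs t
    rw [show t + ((t - s).natAbs : ℤ) = s by omega] at this
    rw [← RAAG.wordLength_inv]
    simpa using this

lemma wordLength_gen_le (c : ZMod (N + 4)) : ‖gen N c‖ₙ ≤ 1 := RAAG.wordLength_of_le _ _

lemma wordLength_branch (s t : ℤ) (ε : Bool) (j : ℕ) :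
    ‖(spine N s)⁻¹ * branch N t ε j‖ₙ ≤ 2 * (t - 1 - s).natAbs + 1 + j := by
  induction j with
  | zero =>
    rw [branch, ← mul_assoc]
    refine (RAAG.wordLength_mul_le _ _ _).trans ?_
    have := wordLength_spine (N := N) s (t - 1)
    have := wordLength_gen_le (absc N (.X t) (if ε then 0 else 1))
    omega
  | succ j ih =>
    rw [branch, ← mul_assoc]
    refine (RAAG.wordLength_mul_le _ _ _).trans ?_
    have := wordLength_gen_le (absc N (.Y t ε j) 4)
    omega

lemma wordLength_gen_pow (c : ZMod (N + 4)) (k : ℕ) : ‖gen N c ^ k‖ₙ ≤ k := by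
  induction k with
  | zero => simp [RAAG.wordLength_one]
  | succ k ih =>
    rw [pow_succ]
    exact (RAAG.wordLength_mul_le _ _ _).trans (Nat.add_le_add ih (RAAG.wordLength_of_le _ _))

lemma mult_le (v : LV) : mult N v ≤ 2 := by
  cases v <;> simp only [mult] <;> (try split_ifs) <;> omega

lemma one_le_mult (v : LV) : 1 ≤ mult N v := by
  cases v <;> simp only [mult] <;> (try split_ifs) <;> omega

lemma label_inRange (σ : State m) (i : ZMod m) : InRange N p (label N p q m σ i) := by
  rcases h : label N p q m σ i with y | y | ⟨t, ε, k⟩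
  · trivial
  · trivial
  · obtain ⟨h1, h2, -, -, rfl⟩ := walk_eq_lf.1 h
    constructor <;> omega

/-- Tiles carrying labels of a state lie close to the base point of the state. -/
lemma wordLength_base_le (hN : 3 ≤ N) [NeZero m] (hm : m = N + 4 + p * N + q * (N + 2))
    {σ : State m} {i : ZMod m} {x : Pos} {d : ℕ} (hd : d < N + 4)
    (h : lab N p x d = some (label N p q m σ i)) :
    ‖(spine N σ.l)⁻¹ * base N x‖ₙ ≤ 2 * (q + 3) + 1 + p := by
  obtain ⟨t, ht, hj⟩ : ∃ t : ℤ, (t - σ.l).natAbs ≤ q + 2 ∧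
      (x = .X t ∨ ∃ ε j, j < p ∧ x = .Y t ε j) := by
    have hk := (i - σ.r).val_lt
    rcases hv : label N p q m σ i with y | y | ⟨t, ε, k⟩ <;> rw [hv] at h
    · obtain ⟨h1, h2⟩ := walk_eq_top.1 hv
      have h3 : (tc q σ.ε : ℤ) ≤ 2 * q + 4 := by unfold tc; split_ifs <;> push_cast <;> omega
      cases x with
      | X t =>
        refine ⟨t, ?_, .inl rfl⟩
        grind [lab]
      | Y t ε j =>
        refine ⟨t, ?_, .inr ⟨ε, j, ?_, rfl⟩⟩ <;> grind [lab, sgn]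
    · obtain ⟨h1, h2⟩ := walk_eq_bot.1 hv
      have h3 : (2 * q + 2 : ℤ) ≤ tc q σ.ε := by unfold tc; split_ifs <;> push_cast <;> omega
      have h4 : y ≤ N * σ.l + 1 := by
        have : (m : ℤ) = N + 4 + p * N + q * (N + 2) := by exact_mod_cast hm
        have : (tc q σ.ε + p * N : ℤ) ≤ (i - σ.r).val := by exact_mod_cast h1
        nlinarith
      have h5 : N * (σ.l - 1 - q) ≤ y := by omega
      have hpos : (0 : ℤ) < N := by omega
      have key : ∀ t : ℤ, N * t - 1 ≤ y → y ≤ N * t + N → (t - σ.l).natAbs ≤ q + 2 := by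
        intro t h6 h7
        have h8 : t < σ.l + 1 := lt_of_mul_lt_mul_left (a := (N : ℤ)) (by linarith) hpos.le
        have h9 : σ.l - 1 - q ≤ t + 1 := le_of_mul_le_mul_left (a := (N : ℤ)) (by linarith) hpos
        omega
      cases x with
      | X t =>
        refine ⟨t, key t ?_ ?_, .inl rfl⟩ <;> grind [lab]
      | Y t ε j =>
        refine ⟨t, key t ?_ ?_, .inr ⟨ε, j, ?_, rfl⟩⟩ <;> grind [lab, sgn]
    · obtain ⟨h1, h2, rfl, -, -⟩ := walk_eq_lf.1 hv
      cases x with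
      | X t => grind [lab]
      | Y t ε' j =>
        refine ⟨t, ?_, .inr ⟨ε', j, ?_, rfl⟩⟩ <;> grind [lab]
  rcases hj with rfl | ⟨ε, j, hj, rfl⟩
  · have := wordLength_spine (N := N) σ.l t
    simp only [base]
    omega
  · have := wordLength_branch (N := N) σ.l t ε j
    simp only [base]
    omega

lemma natAbs_trans_l_le (hN : 3 ≤ N) (σ : State m) (i : ZMod m) :
    ((trans N p q m i σ).l - σ.l).natAbs ≤ q + 1 := by
  by_cases h : Active N q σ.l (label N p q m σ i)
  · rcases hv : label N p q m σ i with y | y | ⟨t, ε, k⟩ <;> rw [hv] at h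
    · obtain ⟨t, rfl, h1, h2⟩ := h
      rw [trans_top hv h1 h2]
      dsimp only
      omega
    · obtain ⟨t, rfl, h1, h2⟩ := h
      rw [trans_bot hN hv h1 h2]
      dsimp only
      omega
    · exact h.elim
  · simp [trans_of_not hN h]

lemma wordLength_step_le (hN : 3 ≤ N) (hp : 1 ≤ p) [NeZero m]
    (hm : m = N + 4 + p * N + q * (N + 2)) (σ : State m) (i : ZMod m) (b : Bool) :
    ‖(spine N σ.l)⁻¹ * psi hN hp (RAAG.val _ (RAAG.dbl (label N p q m σ i, b))) *
      spine N (trans N p q m i σ).l‖ₙ ≤ 4 * (q + 3) + 2 + 2 * p + 4 + 2 * (q + 1) := by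
  obtain ⟨x, d, hd, h⟩ := (label_inRange (p := p) (q := q) σ i).exists_tile hN hp
  have hb := wordLength_base_le hN hm hd h
  have hl := natAbs_trans_l_le (N := N) (p := p) (q := q) hN σ i
  have hs := wordLength_spine (N := N) σ.l (trans N p q m i σ).l
  set B := (spine N σ.l)⁻¹ * base N x with hB
  have hBi : ‖B⁻¹‖ₙ ≤ 2 * (q + 3) + 1 + p := (RAAG.wordLength_inv _ _).trans_le hb
  obtain ⟨u, hu, hu'⟩ : ∃ u, ‖u‖ₙ ≤ 4 ∧
      psi hN hp (RAAG.val _ (RAAG.dbl (label N p q m σ i, b))) =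
        base N x * u * (base N x)⁻¹ := by
    have hm2 := mult_le (N := N) (label N p q m σ i)
    cases b
    · refine ⟨(gen N (absc N x d) ^ mult N (label N p q m σ i))⁻¹, ?_, ?_⟩
      · rw [RAAG.wordLength_inv]
        have := wordLength_gen_pow (absc N x d) (mult N (label N p q m σ i))
        omega
      · simp only [RAAG.dbl, Bool.false_eq_true, if_false, RAAG.val_cons, RAAG.val_nil, one_mul,
          RAAG.letterVal, map_inv, psi_of hN hp hd h]
        group
    · refine ⟨gen N (absc N x d) ^ (mult N (label N p q m σ i) + mult N (label N p q m σ i)),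
        ?_, ?_⟩
      · have := wordLength_gen_pow (absc N x d)
          (mult N (label N p q m σ i) + mult N (label N p q m σ i))
        omega
      · simp only [RAAG.dbl, if_true, RAAG.val_cons, RAAG.val_nil, one_mul,
          RAAG.letterVal, map_mul, psi_of hN hp hd h, pow_add]
        group
  have e : (spine N σ.l)⁻¹ * psi hN hp (RAAG.val _ (RAAG.dbl (label N p q m σ i, b))) *
      spine N (trans N p q m i σ).l =
      B * u * B⁻¹ * ((spine N σ.l)⁻¹ * spine N (trans N p q m i σ).l) := by
    rw [hu', hB]; group
  rw [e]
  refine (RAAG.wordLength_mul_le _ _ _).trans ?_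
  have h1 := RAAG.wordLength_mul_le _ (B * u) B⁻¹
  have h2 := RAAG.wordLength_mul_le _ B u
  omega

end Estimates

section Embedding

variable {N p q m : ℕ} (hN : 3 ≤ N) (hp : 1 ≤ p) [NeZero m]
  (hm : m = N + 4 + p * N + q * (N + 2))

/-- The initial state. -/
def initial (m : ℕ) : State m := ⟨0, true, 0⟩

/-- The embedding of the group of the long cycle. -/
noncomputable def embed (g : RAAG (cycleGraph m)) : RAAG (cycleGraph (N + 4)) :=
  psi hN hp ((machine hN hp hm).map (initial m) g) *
    spine N ((machine hN hp hm).state (initial m) g).l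

lemma im_inRange (σ : State m) (w : List (ZMod m × Bool)) :
    ∀ b ∈ RAAG.dblw ((machine hN hp hm).im σ w), InRange N p b.1 := by
  induction w with
  | nil => simp [RAAG.Machine.im, RAAG.dblw]
  | cons a w ih =>
    intro b hb
    simp only [RAAG.Machine.im, RAAG.dblw, List.mem_append] at hb
    rcases hb with hb | hb
    · have : b.1 = label N p q m ((machine hN hp hm).st σ w) a.1 := by
        simp only [RAAG.dbl] at hb
        split_ifs at hb <;> simp at hb <;> simp [hb, machine]
      rw [this]
      exact label_inRange _ _
    · exact ih b hb

lemma act_embed (g : RAAG (cycleGraph m)) :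
    ((tiling hN hp).act (1, .X 0) (embed hN hp hm g)).1 =
      (machine hN hp hm).map (initial m) g := by
  rw [embed, Tiling.act_mul]
  have h : (tiling hN hp).act (1, .X 0) (psi hN hp ((machine hN hp hm).map (initial m) g)) =
      (1 * (machine hN hp hm).map (initial m) g, .X 0) :=
    act_psi_val hN hp 1 (im_inRange hN hp hm _ _)
  rw [h, act_spine, one_mul]

lemma le_wordLength_embed (g h : RAAG (cycleGraph m)) :
    wordLength (raagGen (cycleGraph m)) (g⁻¹ * h) ≤
      wordLength (raagGen (cycleGraph (N + 4)))
        ((embed hN hp hm g)⁻¹ * embed hN hp hm h) := by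
  refine ((machine hN hp hm).wordLength_le_map (initial m) g h).trans ?_
  rw [← act_embed, ← act_embed]
  exact Tiling.wordLength_act_le _ _ _ _

lemma exists_wordLength_embed_le : ∃ C : ℕ, ∀ g h : RAAG (cycleGraph m),
    wordLength (raagGen (cycleGraph (N + 4))) ((embed hN hp hm g)⁻¹ * embed hN hp hm h) ≤
      C * wordLength (raagGen (cycleGraph m)) (g⁻¹ * h) := by
  refine ⟨4 * (q + 3) + 2 + 2 * p + 4 + 2 * (q + 1), RAAG.le_mul_wordLength _ _ _ fun g a => ?_⟩
  rcases (machine hN hp hm).step (initial m) g a with ⟨h1, h2⟩ | ⟨h1, h2⟩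
  · convert wordLength_step_le hN hp hm ((machine hN hp hm).state (initial m) g) a.1 a.2 using 1
    rw [embed, embed, h1, h2, map_mul]
    simp only [machine]
    group
  · rw [← RAAG.wordLength_inv]
    convert wordLength_step_le hN hp hm
      ((machine hN hp hm).state (initial m) (g * RAAG.letterVal _ a)) a.1 (!a.2) using 1
    rw [embed, embed, h1, h2, map_mul]
    simp only [machine]
    group

end Embedding

end Ladder

namespace RAAG

section Exponent

variable {V : Type*} (Γ : SimpleGraph V)

/-- The exponent sum homomorphism. -/
def expSum : RAAG Γ →* Multiplicative ℤ :=
  lift (fun _ => Multiplicative.ofAdd 1) fun _ _ _ => Commute.all _ _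

lemma natAbs_expSum_le (g : RAAG Γ) :
    (expSum Γ g).toAdd.natAbs ≤ wordLength (raagGen Γ) g := by
  obtain ⟨w, rfl, hw⟩ := exists_val_length_eq Γ g
  rw [← hw]
  clear hw
  induction w with
  | nil => simp
  | cons a w ih =>
    have h : (expSum Γ (letterVal Γ a)).toAdd.natAbs = 1 := by
      rcases a with ⟨v, _ | _⟩ <;> simp [letterVal, expSum]
    rw [val_cons, map_mul, toAdd_mul, List.length_cons]
    omega

end Exponent

end RAAG

namespace Ladder

variable {N p q m : ℕ} (hN : 3 ≤ N) (hp : 1 ≤ p)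

lemma expSum_psi_of {v : LV} (hv : InRange N p v) :
    (RAAG.expSum _ (psi hN hp (PresentedGroup.of v))).toAdd = mult N v := by
  obtain ⟨x, d, hd, h⟩ := hv.exists_tile hN hp
  rw [psi_of hN hp hd h]
  simp [RAAG.expSum, gen]

variable [NeZero m] (hm : m = N + 4 + p * N + q * (N + 2))

lemma embed_letterVal_pow (b : Bool) (k : ℕ) :
    embed hN hp hm (RAAG.letterVal _ (0, b) ^ k) =
      psi hN hp (RAAG.val _ (RAAG.dbl (label N p q m (initial m) 0, b))) ^ k := by
  have ht : trans N p q m 0 (initial m) = initial m := by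
    refine trans_of_not hN fun h => ?_
    have hv : label N p q m (initial m) 0 = .top (2 * (0 - 1 - q)) :=
      walk_eq_top.2 (by simp [initial, tc])
    rw [hv] at h
    obtain ⟨t, h1, h2, -⟩ := h
    simp only [initial] at h2
    omega
  obtain ⟨h1, h2⟩ := (machine hN hp hm).map_pow (initial m) (0, b) ht k
  rw [embed, h1, h2, map_pow]
  simp [machine, initial, spine]

lemma not_atFiniteDist_embed (φ : RAAG (cycleGraph m) →* RAAG (cycleGraph (N + 4))) :
    ¬ AtFiniteDist (raagGen (cycleGraph (N + 4))) (embed hN hp hm) (fun g => φ g) := by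
  rintro ⟨C, hC⟩
  set v := label N p q m (initial m) 0 with hv
  have he := expSum_psi_of hN hp (label_inRange (p := p) (q := q) (initial m) 0)
  rw [← hv] at he
  have he1 := one_le_mult (N := N) v
  set b := (RAAG.expSum _ (φ (PresentedGroup.of 0))).toAdd with hb
  have bound : ∀ g, (((RAAG.expSum _ (φ g)).toAdd -
      (RAAG.expSum _ (embed hN hp hm g)).toAdd).natAbs : ℝ) ≤ C := by
    intro g
    refine le_trans ?_ (hC g)
    have := RAAG.natAbs_expSum_le _ ((embed hN hp hm g)⁻¹ * φ g)
    rw [map_mul, map_inv, toAdd_mul, toAdd_inv, neg_add_eq_sub] at this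
    rw [wordDist]
    exact_mod_cast this
  obtain ⟨k, hk⟩ := exists_nat_gt (2 * C)
  have h1 := bound (RAAG.letterVal _ (0, true) ^ k)
  have h2 := bound (RAAG.letterVal _ (0, false) ^ k)
  rw [embed_letterVal_pow] at h1 h2
  simp only [RAAG.letterVal, RAAG.dbl, if_true, Bool.false_eq_true, if_false, RAAG.val_cons,
    RAAG.val_nil, one_mul, map_pow, map_mul, map_inv, toAdd_pow, toAdd_mul, toAdd_inv, ← hv, he, ← hb,
    nsmul_eq_mul] at h1 h2
  have h3 : k ≤ ((k : ℤ) * b - k * (mult N v + mult N v)).natAbs +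
      ((k : ℤ) * -b - k * -mult N v).natAbs := by
    have : (k : ℤ) ≤ k * mult N v := by exact_mod_cast Nat.le_mul_of_pos_right k he1
    rw [mul_neg, mul_neg, mul_add]
    omega
  have h4 : (k : ℝ) ≤ (((k : ℤ) * b - k * (mult N v + mult N v)).natAbs : ℝ) +
      (((k : ℤ) * -b - k * -mult N v).natAbs : ℝ) := by exact_mod_cast h3
  linarith

lemma isQIEWith_embed : IsQIEWith (wordDist (raagGen (cycleGraph m)))
    (wordDist (raagGen (cycleGraph (N + 4)))) (embed hN hp hm) := by
  obtain ⟨C, hC⟩ := exists_wordLength_embed_le hN hp hm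
  refine ⟨max 1 C, 0, le_max_left _ _, le_rfl, fun g h => ⟨?_, ?_⟩⟩
  · have h0 : (0 : ℝ) ≤ wordDist (raagGen (cycleGraph m)) g h := Nat.cast_nonneg _
    have h1 : 1 / max 1 (C : ℝ) ≤ 1 := by
      rw [div_le_one (by positivity)]; exact le_max_left _ _
    simp only [wordDist] at h0 ⊢
    calc 1 / max 1 (C : ℝ) * (wordLength (raagGen (cycleGraph m)) (g⁻¹ * h) : ℝ) - 0
        ≤ wordLength (raagGen (cycleGraph m)) (g⁻¹ * h) := by
          rw [sub_zero]; exact mul_le_of_le_one_left h0 h1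
      _ ≤ _ := by exact_mod_cast le_wordLength_embed hN hp hm g h
  · simp only [wordDist, add_zero]
    calc _ ≤ (C : ℝ) * wordLength (raagGen (cycleGraph m)) (g⁻¹ * h) := by exact_mod_cast hC g h
      _ ≤ _ := mul_le_mul_of_nonneg_right (le_max_right _ _) (Nat.cast_nonneg _)

end Ladder

/-- For `n > 6` and `m = n + p(n-4) + q(n-2)` with `p, q ≥ 1`, there is a
quasiisometric embedding `A_{C_m} → A_{C_n}` not at finite distance from any homomorphism. -/
theorem qie_far_from_homomorphisms (n p q m : ℕ) (hn : 6 < n) (hp : 1 ≤ p) (hq : 1 ≤ q)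
    (hm : m = n + p * (n - 4) + q * (n - 2)) :
    ∃ F : RAAG (cycleGraph m) → RAAG (cycleGraph n),
      IsQIEWith (wordDist (raagGen (cycleGraph m))) (wordDist (raagGen (cycleGraph n))) F ∧
      ∀ φ : RAAG (cycleGraph m) →* RAAG (cycleGraph n),
        ¬ AtFiniteDist (raagGen (cycleGraph n)) F (fun g => φ g) := by
  obtain ⟨N, rfl⟩ : ∃ N, n = N + 4 := ⟨n - 4, by omega⟩
  rw [show N + 4 - 4 = N by omega, show N + 4 - 2 = N + 2 by omega] at hm
  have hN : 3 ≤ N := by omega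
  have : NeZero m := ⟨by omega⟩
  exact ⟨Ladder.embed hN hp hm, Ladder.isQIEWith_embed hN hp hm,
    Ladder.not_atFiniteDist_embed hN hp hm⟩
end

section
/- Let n > 6 and let m = n + p(n−4) for some integer p ≥ 1. Then there exists an injective group homomorphism A_{C_m} → A_{C_n} that is a quasiisometric embedding with respect to the word metrics. -/
open scoped symmDiff

namespace RAAGCycle

section WordLength

variable {G : Type*} [Group G] {S : Set G}

/-- A word in the elements of `S` and their inverses. -/
def IsWord (S : Set G) (w : List G) : Prop := ∀ x ∈ w, x ∈ S ∨ x⁻¹ ∈ S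

theorem wordLength_prod_le {w : List G} (hw : IsWord S w) : wordLength S w.prod ≤ w.length :=
  Nat.sInf_le ⟨w, rfl, hw, rfl⟩

theorem exists_minimal_word (hS : Subgroup.closure S = ⊤) (g : G) :
    ∃ w : List G, w.length = wordLength S g ∧ IsWord S w ∧ w.prod = g := by
  have hg : g ∈ (Subgroup.closure S).toSubmonoid := hS ▸ Subgroup.mem_top g
  rw [Subgroup.closure_toSubmonoid] at hg
  obtain ⟨w, hw, rfl⟩ := Submonoid.exists_list_of_mem_closure hg
  exact Nat.sInf_mem
    (s := {k | ∃ v : List G, v.length = k ∧ (∀ x ∈ v, x ∈ S ∨ x⁻¹ ∈ S) ∧ v.prod = w.prod})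
    ⟨_, w, rfl, hw, rfl⟩

theorem wordLength_mul_le (hS : Subgroup.closure S = ⊤) (g h : G) :
    wordLength S (g * h) ≤ wordLength S g + wordLength S h := by
  obtain ⟨v, hv, hvS, rfl⟩ := exists_minimal_word hS g
  obtain ⟨w, hw, hwS, rfl⟩ := exists_minimal_word hS h
  rw [← hv, ← hw, ← List.prod_append, ← List.length_append]
  refine wordLength_prod_le fun x hx => ?_
  rcases List.mem_append.1 hx with hx | hx
  exacts [hvS x hx, hwS x hx]

theorem wordLength_one : wordLength S 1 = 0 :=
  Nat.le_zero.1 (wordLength_prod_le (w := []) (by simp [IsWord]))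

theorem wordLength_inv_le (hS : Subgroup.closure S = ⊤) (g : G) :
    wordLength S g⁻¹ ≤ wordLength S g := by
  obtain ⟨v, hv, hvS, rfl⟩ := exists_minimal_word hS g
  rw [← hv, List.prod_inv_reverse]
  refine (wordLength_prod_le fun x hx => ?_).trans (by simp)
  simp only [List.mem_reverse, List.mem_map] at hx
  obtain ⟨y, hy, rfl⟩ := hx
  simpa using (hvS y hy).symm

theorem wordLength_le_one {x : G} (hx : x ∈ S ∨ x⁻¹ ∈ S) : wordLength S x ≤ 1 := by
  simpa using wordLength_prod_le (S := S) (w := [x]) (by simpa [IsWord] using hx)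

/-- A homomorphism which is bounded on generators is Lipschitz. -/
theorem wordLength_map_le {H : Type*} [Group H] {T : Set H} (hS : Subgroup.closure S = ⊤)
    (hT : Subgroup.closure T = ⊤) (F : G →* H) {K : ℕ} (hK : ∀ x ∈ S, wordLength T (F x) ≤ K)
    (g : G) : wordLength T (F g) ≤ K * wordLength S g := by
  obtain ⟨w, hw, hwS, rfl⟩ := exists_minimal_word hS g
  rw [← hw]
  clear hw
  induction w with
  | nil => simp [wordLength_one]
  | cons x w ih =>
    have h1 : wordLength T (F x) ≤ K := by
      rcases hwS x (by simp) with h | h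
      · exact hK x h
      · have := wordLength_inv_le hT (F x⁻¹)
        rw [← map_inv, inv_inv] at this
        exact this.trans (hK _ h)
    have h2 := ih fun y hy => hwS y (by simp [hy])
    rw [List.prod_cons, map_mul, List.length_cons, mul_add, mul_one]
    have := wordLength_mul_le hT (F x) (F w.prod)
    omega

/-- If `G` acts on `R × Q` so that generators and their inverses change the length of the first
coordinate by at most one, then the length of an orbit point is at most the length of the group
element. -/
theorem wordLength_orbit_le {R Q : Type*} [Group R] {T : Set R} (hS : Subgroup.closure S = ⊤)
    (Ψ : G →* Equiv.Perm (R × Q)) (q₀ : Q)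
    (hΨ : ∀ x ∈ S, ∀ y : R × Q, wordLength T (Ψ x y).1 ≤ wordLength T y.1 + 1)
    (hΨ' : ∀ x ∈ S, ∀ y : R × Q, wordLength T ((Ψ x)⁻¹ y).1 ≤ wordLength T y.1 + 1) (g : G) :
    wordLength T (Ψ g (1, q₀)).1 ≤ wordLength S g := by
  obtain ⟨w, hw, hwS, rfl⟩ := exists_minimal_word hS g
  rw [← hw]
  clear hw
  induction w with
  | nil => simp [wordLength_one]
  | cons x w ih =>
    have h2 := ih fun y hy => hwS y (by simp [hy])
    rw [List.prod_cons, map_mul, List.length_cons, Equiv.Perm.mul_apply]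
    refine le_trans ?_ (Nat.add_le_add_right h2 1)
    rcases hwS x (by simp) with h | h
    · exact hΨ x h _
    · simpa using hΨ' _ h (Ψ w.prod (1, q₀))

end WordLength

section Presentation

theorem closure_raagGen {V : Type*} (Γ : SimpleGraph V) : Subgroup.closure (raagGen Γ) = ⊤ :=
  PresentedGroup.closure_range_of _

theorem commute_of_adj {V : Type*} {Γ : SimpleGraph V} {v w : V} (h : Γ.Adj v w) :
    Commute (PresentedGroup.of v : RAAG Γ) (PresentedGroup.of w) := by
  have h1 : (PresentedGroup.mk (raagRels Γ)) (FreeGroup.of v * FreeGroup.of w *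
      (FreeGroup.of v)⁻¹ * (FreeGroup.of w)⁻¹) = 1 :=
    PresentedGroup.one_of_mem ⟨v, w, h, rfl⟩
  simp only [map_mul, map_inv] at h1
  exact mul_inv_eq_iff_eq_mul.1 (mul_inv_eq_one.1 h1)

/-- The generator of the right-angled Artin group of a cycle indexed by a natural number. -/
def gen (n i : ℕ) : RAAG (cycleGraph n) := PresentedGroup.of (i : ZMod n)

theorem gen_mem (n i : ℕ) : gen n i ∈ raagGen (cycleGraph n) := ⟨_, rfl⟩

theorem commute_gen_succ (n i : ℕ) : Commute (gen n i) (gen n (i + 1)) := by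
  by_cases h : (i : ZMod n) = ((i + 1 : ℕ) : ZMod n)
  · unfold gen
    rw [← h]
  · exact commute_of_adj ((SimpleGraph.fromRel_adj _ _ _).2 ⟨h, Or.inl (by push_cast; rfl)⟩)

theorem gen_self (n : ℕ) : gen n n = gen n 0 := by
  simp [gen]

theorem commute_gen_last {n : ℕ} (hn : 1 ≤ n) : Commute (gen n (n - 1)) (gen n 0) := by
  have := commute_gen_succ n (n - 1)
  rwa [Nat.sub_add_cancel hn, gen_self] at this

theorem exists_eq_gen {n : ℕ} (hn : 1 ≤ n) {x : RAAG (cycleGraph n)}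
    (hx : x ∈ raagGen (cycleGraph n)) : ∃ i < n, x = gen n i := by
  have : NeZero n := ⟨by omega⟩
  obtain ⟨v, rfl⟩ := hx
  exact ⟨v.val, v.val_lt, by simp [gen]⟩

/-- A cyclic sequence of consecutively commuting elements defines a homomorphism. -/
theorem exists_hom_of_commute {H : Type*} [Group H] {n : ℕ} (hn : 2 ≤ n) (h : ℕ → H)
    (h1 : ∀ i, i + 1 < n → Commute (h i) (h (i + 1))) (h2 : Commute (h (n - 1)) (h 0)) :
    ∃ φ : RAAG (cycleGraph n) →* H, ∀ i < n, φ (gen n i) = h i := by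
  have : NeZero n := ⟨by omega⟩
  have : Fact (1 < n) := ⟨hn⟩
  have key : ∀ v : ZMod n, Commute (h v.val) (h (v + 1).val) := by
    intro v
    have hv := v.val_lt
    rcases Nat.lt_or_ge (v.val + 1) n with hlt | hge
    · rw [ZMod.val_add_of_lt (by rwa [ZMod.val_one]), ZMod.val_one]
      exact h1 _ hlt
    · have hval : v.val = n - 1 := by omega
      have : v + 1 = 0 := by
        rw [← ZMod.natCast_zmod_val v, hval, ← Nat.cast_succ, Nat.succ_eq_add_one,
          Nat.sub_add_cancel (by omega), ZMod.natCast_self]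
      rw [this, hval, ZMod.val_zero]
      exact h2
  have hrel : ∀ r ∈ raagRels (cycleGraph n), FreeGroup.lift (fun v : ZMod n => h v.val) r = 1 := by
    rintro r ⟨v, w, hvw, rfl⟩
    have hc : Commute (h v.val) (h w.val) := by
      rcases ((SimpleGraph.fromRel_adj _ _ _).1 hvw).2 with rfl | rfl
      · exact key v
      · exact (key w).symm
    simp only [map_mul, map_inv, FreeGroup.lift_apply_of]
    rw [hc.eq]
    group
  refine ⟨PresentedGroup.toGroup hrel, fun i hi => ?_⟩
  rw [gen, PresentedGroup.toGroup.of, ZMod.val_cast_of_lt hi]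

end Presentation

section Action

variable (d p : ℕ)

/-- The position, in the `q`-th copy of the path `0, …, d + 2`, of the vertex `i`; odd copies are
traversed backwards. -/
def flip (q i : ℕ) : ℕ := if q % 2 = 0 then i else d + 2 - i

variable {d p}

theorem flip_le {q i : ℕ} (hi : i ≤ d + 2) : flip d q i ≤ d + 2 := by
  unfold flip; split_ifs <;> omega

theorem flip_flip {q i : ℕ} (hi : i ≤ d + 2) : flip d q (flip d q i) = i := by
  unfold flip; split_ifs <;> omega

theorem flip_succ {q i : ℕ} (hi : i ≤ d + 2) : flip d (q + 1) i = d + 2 - flip d q i := by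
  unfold flip; split_ifs <;> omega

variable {R : Type*} [Group R] (W : ℕ → R)

variable (d p) in
/-- The action of the `i`-th path vertex: it moves between neighbouring copies that are glued along
its star, and multiplies by its label otherwise. -/
def pathStep (i : ℕ) (x : R × ℕ) : R × ℕ :=
  if flip d x.2 i = d + 2 ∧ x.2 < p then (x.1, x.2 + 1)
  else if flip d x.2 i = 0 ∧ 0 < x.2 ∧ x.2 ≤ p then (x.1, x.2 - 1)
  else (W (x.2 * d + flip d x.2 i) * x.1, x.2)

variable (p) in
/-- The action of the apex. -/
def apexStep (a : R) (x : R × ℕ) : R × ℕ := if x.2 ≤ p then (a * x.1, x.2) else x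

theorem pathStep_up {i q : ℕ} (r : R) (h : flip d q i = d + 2) (hq : q < p) :
    pathStep d p W i (r, q) = (r, q + 1) := if_pos ⟨h, hq⟩

theorem pathStep_down {i q : ℕ} (r : R) (h : flip d (q + 1) i = 0) (hq : q < p) :
    pathStep d p W i (r, q + 1) = (r, q) := by
  simp [pathStep, h, hq]

theorem pathStep_stay {i q : ℕ} (r : R) (h : ¬ (flip d q i = d + 2 ∧ q < p))
    (h' : ¬ (flip d q i = 0 ∧ 0 < q ∧ q ≤ p)) :
    pathStep d p W i (r, q) = (W (q * d + flip d q i) * r, q) := by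
  rw [pathStep, if_neg h, if_neg h']

theorem pathStep_leftInverse {i : ℕ} (hi : i ≤ d + 2) {W' : ℕ → R} (hW : ∀ k, W' k * W k = 1) :
    Function.LeftInverse (pathStep d p W' i) (pathStep d p W i) := by
  rintro ⟨r, q⟩
  by_cases h : flip d q i = d + 2 ∧ q < p
  · rw [pathStep_up W r h.1 h.2, pathStep_down W' r (by rw [flip_succ hi]; omega) h.2]
  by_cases h' : flip d q i = 0 ∧ 0 < q ∧ q ≤ p
  · obtain ⟨q, rfl⟩ : ∃ s, q = s + 1 := ⟨q - 1, by omega⟩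
    have := flip_succ (q := q) hi
    have := flip_le (q := q) hi
    rw [pathStep_down W r h'.1 (by omega), pathStep_up W' r (by omega) (by omega)]
  · rw [pathStep_stay W r h h', pathStep_stay W' _ h h', ← mul_assoc, hW, one_mul]

theorem apexStep_leftInverse {a b : R} (h : b * a = 1) :
    Function.LeftInverse (apexStep p b) (apexStep p a) := by
  rintro ⟨r, q⟩
  by_cases hq : q ≤ p
  · simp [apexStep, hq, ← mul_assoc, h]
  · simp [apexStep, hq]

theorem pathStep_comm_aux (hd : 1 ≤ d) (hW : ∀ k, Commute (W k) (W (k + 1))) {i i' q : ℕ}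
    (hi : i ≤ d + 2) (hi' : i' ≤ d + 2) (h : flip d q i' = flip d q i + 1) (r : R) :
    pathStep d p W i (pathStep d p W i' (r, q)) = pathStep d p W i' (pathStep d p W i (r, q)) := by
  have hle := flip_le (q := q) hi
  have hle' := flip_le (q := q) hi'
  have hs := flip_succ (q := q) hi
  by_cases h1 : flip d q i' = d + 2 ∧ q < p
  · rw [pathStep_up W r h1.1 h1.2, pathStep_stay W r (q := q) (by omega) (by omega),
      pathStep_stay W r (q := q + 1) (by omega) (by omega), pathStep_up W _ h1.1 h1.2]
    congr 3
    rw [Nat.succ_mul]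
    omega
  by_cases h2 : flip d q i = 0 ∧ 0 < q ∧ q ≤ p
  · obtain ⟨q, rfl⟩ : ∃ s, q = s + 1 := ⟨q - 1, by omega⟩
    have := flip_succ (q := q) hi'
    have := flip_le (q := q) hi'
    rw [pathStep_down W r h2.1 (by omega), pathStep_stay W r (q := q + 1) (by omega) (by omega),
      pathStep_stay W r (q := q) (by omega) (by omega), pathStep_down W _ h2.1 (by omega)]
    congr 3
    rw [Nat.succ_mul]
    omega
  · rw [pathStep_stay W r (i := i') h1 (by omega), pathStep_stay W r (i := i) (by omega) h2,
      pathStep_stay W _ (i := i') h1 (by omega), pathStep_stay W _ (i := i) (by omega) h2,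
      h, ← add_assoc, ← mul_assoc, ← mul_assoc, (hW _).eq]

theorem pathStep_comm (hd : 1 ≤ d) (hW : ∀ k, Commute (W k) (W (k + 1))) {i : ℕ}
    (hi : i + 1 ≤ d + 2) (x : R × ℕ) :
    pathStep d p W i (pathStep d p W (i + 1) x) = pathStep d p W (i + 1) (pathStep d p W i x) := by
  obtain ⟨r, q⟩ := x
  rcases Nat.mod_two_eq_zero_or_one q with hq | hq
  · exact pathStep_comm_aux W hd hW (by omega) hi (by simp [flip, hq]) r
  · exact (pathStep_comm_aux W hd hW hi (by omega) (by simp [flip, hq]; omega) r).symm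

theorem apexStep_comm {a : R} (h0 : Commute a (W 0)) (h1 : Commute a (W (p * d + (d + 2)))) {i : ℕ}
    (hi : i = 0 ∨ i = d + 2) (x : R × ℕ) :
    apexStep p a (pathStep d p W i x) = pathStep d p W i (apexStep p a x) := by
  obtain ⟨r, q⟩ := x
  have hfl : flip d q i = 0 ∨ flip d q i = d + 2 := by
    unfold flip; split_ifs <;> omega
  have hle : i ≤ d + 2 := by omega
  by_cases hq : q ≤ p
  · rw [show apexStep p a (r, q) = (a * r, q) from if_pos hq]
    by_cases h : flip d q i = d + 2 ∧ q < p
    · rw [pathStep_up W _ h.1 h.2, pathStep_up W _ h.1 h.2]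
      exact if_pos h.2
    by_cases h' : flip d q i = 0 ∧ 0 < q ∧ q ≤ p
    · obtain ⟨q, rfl⟩ : ∃ s, q = s + 1 := ⟨q - 1, by omega⟩
      rw [pathStep_down W _ h'.1 (by omega), pathStep_down W _ h'.1 (by omega)]
      exact if_pos (by dsimp only; omega)
    · rw [pathStep_stay W _ h h', pathStep_stay W _ h h']
      refine (if_pos hq).trans ?_
      have hc : Commute a (W (q * d + flip d q i)) := by
        rcases hfl with e | e
        · obtain rfl : q = 0 := by omega
          simpa [e] using h0
        · obtain rfl : q = p := by omega
          rwa [e]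
      dsimp only
      rw [← mul_assoc, hc.eq, mul_assoc]
  · rw [show apexStep p a (r, q) = (r, q) from if_neg hq,
      pathStep_stay W r (by omega) (by omega)]
    exact if_neg hq

variable (d p) in
/-- The permutation of `R × ℕ` by which the `i`-th generator acts. -/
def stepPerm (a : R) (i : ℕ) : Equiv.Perm (R × ℕ) :=
  if h : i ≤ d + 2 then
    { toFun := pathStep d p W i
      invFun := pathStep d p (fun k => (W k)⁻¹) i
      left_inv := pathStep_leftInverse W h (by simp)
      right_inv := pathStep_leftInverse _ h (by simp) }
  else
    { toFun := apexStep p a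
      invFun := apexStep p a⁻¹
      left_inv := apexStep_leftInverse (by simp)
      right_inv := apexStep_leftInverse (by simp) }

theorem stepPerm_path (a : R) {i : ℕ} (h : i ≤ d + 2) (x : R × ℕ) :
    stepPerm d p W a i x = pathStep d p W i x := by
  rw [stepPerm, dif_pos h]; rfl

theorem stepPerm_path_inv (a : R) {i : ℕ} (h : i ≤ d + 2) (x : R × ℕ) :
    (stepPerm d p W a i)⁻¹ x = pathStep d p (fun k => (W k)⁻¹) i x := by
  rw [stepPerm, dif_pos h]; rfl

theorem stepPerm_apex (a : R) (x : R × ℕ) :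
    stepPerm d p W a (d + 3) x = apexStep p a x := by
  rw [stepPerm, dif_neg (by omega)]; rfl

theorem stepPerm_apex_inv (a : R) (x : R × ℕ) :
    (stepPerm d p W a (d + 3))⁻¹ x = apexStep p a⁻¹ x := by
  rw [stepPerm, dif_neg (by omega)]; rfl

theorem wordLength_pathStep_le {T : Set R} (hT : Subgroup.closure T = ⊤)
    (hW : ∀ k, W k ∈ T ∨ (W k)⁻¹ ∈ T) (i : ℕ) (x : R × ℕ) :
    wordLength T (pathStep d p W i x).1 ≤ wordLength T x.1 + 1 := by
  unfold pathStep
  split_ifs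
  · exact Nat.le_succ _
  · exact Nat.le_succ _
  · have := wordLength_mul_le hT (W (x.2 * d + flip d x.2 i)) x.1
    have := wordLength_le_one (hW (x.2 * d + flip d x.2 i))
    dsimp only
    omega

theorem wordLength_apexStep_le {T : Set R} (hT : Subgroup.closure T = ⊤)
    {a : R} (ha : a ∈ T ∨ a⁻¹ ∈ T) (x : R × ℕ) :
    wordLength T (apexStep p a x).1 ≤ wordLength T x.1 + 1 := by
  unfold apexStep
  split_ifs
  · have := wordLength_mul_le hT a x.1
    have := wordLength_le_one ha
    dsimp only
    omega
  · exact Nat.le_succ _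

/-- The action of the right-angled Artin group of the short cycle. -/
theorem exists_action (hd : 1 ≤ d) {a : R} (hW : ∀ k, Commute (W k) (W (k + 1)))
    (h0 : Commute a (W 0)) (h1 : Commute a (W (p * d + (d + 2)))) :
    ∃ Ψ : RAAG (cycleGraph (d + 4)) →* Equiv.Perm (R × ℕ),
      ∀ i < d + 4, Ψ (gen (d + 4) i) = stepPerm d p W a i := by
  refine exists_hom_of_commute (by omega) _ (fun i hi => Equiv.ext fun x => ?_)
    (Equiv.ext fun x => ?_)
  · rw [Equiv.Perm.mul_apply, Equiv.Perm.mul_apply]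
    rcases Nat.lt_or_ge i (d + 2) with h | h
    · simp only [stepPerm_path W a h.le, stepPerm_path W a (Nat.succ_le_of_lt h)]
      exact pathStep_comm W hd hW h x
    · obtain rfl : i = d + 2 := by omega
      simp only [stepPerm_path W a le_rfl, stepPerm_apex]
      exact (apexStep_comm W h0 h1 (Or.inr rfl) x).symm
  · rw [Equiv.Perm.mul_apply, Equiv.Perm.mul_apply]
    simp only [show d + 4 - 1 = d + 3 from rfl, stepPerm_apex,
      stepPerm_path W a (Nat.zero_le _)]
    exact apexStep_comm W h0 h1 (Or.inl rfl) x

end Action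

section Embedding

variable (d p : ℕ)

/-- The element carrying the zeroth copy to the `q`-th copy. -/
def carrier : ℕ → RAAG (cycleGraph (d + 4))
  | 0 => 1
  | q + 1 => gen (d + 4) (flip d q (d + 2)) * carrier q

/-- The conjugate of a path generator sitting at position `j` of the `q`-th copy. -/
def conjGen (q j : ℕ) : RAAG (cycleGraph (d + 4)) :=
  (carrier d q)⁻¹ * gen (d + 4) (flip d q j) * carrier d q

/-- A copy containing position `k` of the long path. -/
def copyIndex (k : ℕ) : ℕ := min p ((k - 1) / d)

/-- The images of the generators of the long cycle. -/
def imageGen (k : ℕ) : RAAG (cycleGraph (d + 4)) :=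
  if k ≤ p * d + (d + 2) then conjGen d (copyIndex d p k) (k - copyIndex d p k * d)
  else gen (d + 4) (d + 3)

variable {d p}

theorem copyIndex_spec (hd : 1 ≤ d) (k : ℕ) :
    copyIndex d p k ≤ p ∧ (copyIndex d p k = 0 ∨ copyIndex d p k * d + 1 ≤ k) ∧
      (copyIndex d p k = p ∨ k ≤ copyIndex d p k * d + d) := by
  have h1 := Nat.div_mul_le_self (k - 1) d
  have h2 := Nat.lt_div_mul_add (a := k - 1) (b := d) (by omega)
  unfold copyIndex
  rcases le_total p ((k - 1) / d) with h | h
  · rw [min_eq_left h]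
    have := Nat.mul_le_mul_right d h
    refine ⟨le_rfl, ?_, Or.inl rfl⟩
    rcases Nat.eq_zero_or_pos p with rfl | hp
    · exact Or.inl rfl
    · have := Nat.mul_le_mul hp hd
      right; omega
  · rw [min_eq_right h]
    refine ⟨h, ?_, Or.inr (by omega)⟩
    rcases Nat.eq_zero_or_pos ((k - 1) / d) with e | hp
    · exact Or.inl e
    · have := Nat.mul_le_mul hp hd
      right; omega

theorem copyIndex_succ (hd : 1 ≤ d) (k : ℕ) :
    copyIndex d p (k + 1) = copyIndex d p k ∨
      copyIndex d p (k + 1) = copyIndex d p k + 1 ∧ k = copyIndex d p k * d + d := by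
  obtain ⟨h1, h2, h3⟩ := copyIndex_spec (p := p) hd k
  obtain ⟨h1', h2', h3'⟩ := copyIndex_spec (p := p) hd (k + 1)
  set q := copyIndex d p k
  set q' := copyIndex d p (k + 1)
  rcases lt_trichotomy q q' with h | h | h
  · have e := Nat.mul_le_mul_right d (Nat.succ_le_of_lt h)
    rw [Nat.succ_mul] at e
    have hk : k = q * d + d := by omega
    refine Or.inr ⟨?_, hk⟩
    have : q' * d ≤ (q + 1) * d := by rw [Nat.succ_mul]; omega
    have := Nat.le_of_mul_le_mul_right this (by omega)
    omega
  · exact Or.inl h.symm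
  · have e := Nat.mul_le_mul_right d (Nat.succ_le_of_lt h)
    rw [Nat.succ_mul] at e
    omega

theorem commute_conjGen_succ {q j : ℕ} (hj : j + 1 ≤ d + 2) :
    Commute (conjGen d q j) (conjGen d q (j + 1)) := by
  have : Commute (gen (d + 4) (flip d q j)) (gen (d + 4) (flip d q (j + 1))) := by
    unfold flip
    split_ifs
    · exact commute_gen_succ _ _
    · have := commute_gen_succ (d + 4) (d + 2 - (j + 1))
      rw [show d + 2 - (j + 1) + 1 = d + 2 - j by omega] at this
      exact this.symm
  have h := this.map (MulAut.conj (carrier d q)⁻¹)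
  simpa [conjGen, MulAut.conj_apply] using h

theorem conjGen_glue (q : ℕ) : conjGen d (q + 1) 1 = conjGen d q (d + 1) := by
  have hc : Commute (gen (d + 4) (flip d q (d + 2))) (gen (d + 4) (flip d q (d + 1))) := by
    unfold flip
    split_ifs
    · exact (commute_gen_succ _ _).symm
    · simpa [show d + 2 - (d + 1) = 1 by omega] using commute_gen_succ (d + 4) 0
  have e : flip d (q + 1) 1 = flip d q (d + 1) := by
    unfold flip; split_ifs <;> omega
  rw [conjGen, conjGen, carrier, e, mul_inv_rev]
  have : (gen (d + 4) (flip d q (d + 2)))⁻¹ * gen (d + 4) (flip d q (d + 1)) *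
      gen (d + 4) (flip d q (d + 2)) = gen (d + 4) (flip d q (d + 1)) := by
    rw [mul_assoc, ← hc.eq, inv_mul_cancel_left]
  calc _ = (carrier d q)⁻¹ * ((gen (d + 4) (flip d q (d + 2)))⁻¹ *
        gen (d + 4) (flip d q (d + 1)) * gen (d + 4) (flip d q (d + 2))) * carrier d q := by group
    _ = _ := by rw [this]

theorem commute_apex_end {i : ℕ} (hi : i = 0 ∨ i = d + 2) :
    Commute (gen (d + 4) (d + 3)) (gen (d + 4) i) := by
  rcases hi with rfl | rfl
  · exact commute_gen_last (n := d + 4) (by omega)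
  · exact (commute_gen_succ (d + 4) (d + 2)).symm

theorem flip_end {q j : ℕ} (hj : j = 0 ∨ j = d + 2) : flip d q j = 0 ∨ flip d q j = d + 2 := by
  unfold flip; split_ifs <;> omega

theorem commute_apex_carrier (q : ℕ) : Commute (gen (d + 4) (d + 3)) (carrier d q) := by
  induction q with
  | zero => exact Commute.one_right _
  | succ q ih => exact (commute_apex_end (flip_end (Or.inr rfl))).mul_right ih

theorem commute_apex_conjGen {q j : ℕ} (hj : j = 0 ∨ j = d + 2) :
    Commute (gen (d + 4) (d + 3)) (conjGen d q j) :=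
  ((commute_apex_carrier q).inv_right.mul_right (commute_apex_end (flip_end hj))).mul_right
    (commute_apex_carrier q)

theorem commute_imageGen_succ (hd : 1 ≤ d) {k : ℕ} (hk : k ≤ p * d + (d + 2)) :
    Commute (imageGen d p k) (imageGen d p (k + 1)) := by
  obtain ⟨h1, h2, h3⟩ := copyIndex_spec (p := p) hd k
  rcases Nat.lt_or_ge k (p * d + (d + 2)) with h | h
  · rw [imageGen, if_pos hk, imageGen, if_pos (Nat.succ_le_of_lt h)]
    rcases copyIndex_succ (p := p) hd k with e | ⟨e, e'⟩
    · rw [e]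
      generalize copyIndex d p k = q at *
      have hq : q * d ≤ k := by
        rcases h2 with rfl | h2
        · simp
        · omega
      rw [show k + 1 - q * d = k - q * d + 1 by omega]
      apply commute_conjGen_succ
      rcases h3 with rfl | h3 <;> omega
    · rw [e]
      generalize copyIndex d p k = q at *
      rw [show k - q * d = d by omega, show k + 1 - (q + 1) * d = 1 by rw [Nat.succ_mul]; omega,
        conjGen_glue]
      exact commute_conjGen_succ (by omega)
  · obtain rfl : k = p * d + (d + 2) := by omega
    have hq : copyIndex d p (p * d + (d + 2)) = p := by
      rcases h3 with h3 | h3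
      · exact h3
      · by_contra hne
        have := Nat.mul_le_mul_right d h1
        omega
    rw [imageGen, if_pos hk, hq, Nat.add_sub_cancel_left, imageGen, if_neg (by omega)]
    exact (commute_apex_conjGen (Or.inr rfl)).symm

theorem exists_embedding (hd : 1 ≤ d) :
    ∃ F : RAAG (cycleGraph (p * d + (d + 4))) →* RAAG (cycleGraph (d + 4)),
      ∀ k < p * d + (d + 4), F (gen _ k) = imageGen d p k := by
  refine exists_hom_of_commute (by omega) _ (fun k hk => commute_imageGen_succ hd (by omega)) ?_
  have h0 : copyIndex d p 0 = 0 := by simp [copyIndex]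
  rw [imageGen, if_neg (by omega), imageGen, if_pos (by omega), h0]
  simpa using commute_apex_conjGen (d := d) (q := 0) (Or.inl rfl)

variable {R : Type*} [Group R] {W : ℕ → R} {a : R}

theorem carrier_apply {Ψ : RAAG (cycleGraph (d + 4)) →* Equiv.Perm (R × ℕ)}
    (hΨ : ∀ i < d + 4, Ψ (gen (d + 4) i) = stepPerm d p W a i) {q : ℕ} (hq : q ≤ p) (r : R) :
    Ψ (carrier d q) (r, 0) = (r, q) := by
  induction q with
  | zero => simp [carrier]
  | succ q ih =>
    have hle : flip d q (d + 2) ≤ d + 2 := flip_le le_rfl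
    rw [carrier, map_mul, Equiv.Perm.mul_apply, ih (by omega), hΨ _ (by omega),
      stepPerm_path W a hle, pathStep_up W r (flip_flip le_rfl) (by omega)]

theorem imageGen_apply (hd : 1 ≤ d) {Ψ : RAAG (cycleGraph (d + 4)) →* Equiv.Perm (R × ℕ)}
    (hΨ : ∀ i < d + 4, Ψ (gen (d + 4) i) = stepPerm d p W a i) {k : ℕ}
    (hk : k ≤ p * d + (d + 2)) (r : R) : Ψ (imageGen d p k) (r, 0) = (W k * r, 0) := by
  obtain ⟨h1, h2, h3⟩ := copyIndex_spec (p := p) hd k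
  rw [imageGen, if_pos hk]
  generalize copyIndex d p k = q at *
  have hq : q * d ≤ k := by
    rcases h2 with rfl | h2
    · simp
    · omega
  have hj : k - q * d ≤ d + 2 := by
    rcases h3 with rfl | h3 <;> omega
  have hle := flip_le (q := q) hj
  rw [conjGen, map_mul, map_mul, Equiv.Perm.mul_apply, Equiv.Perm.mul_apply, carrier_apply hΨ h1,
    hΨ _ (by omega), stepPerm_path W a hle, pathStep_stay, flip_flip hj, Nat.add_sub_cancel' hq,
    map_inv, Equiv.Perm.inv_eq_iff_eq, carrier_apply hΨ h1]
  · rw [flip_flip hj]; omega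
  · rw [flip_flip hj]; omega

theorem exists_injective_hom_qie (hd : 1 ≤ d) :
    ∃ F : RAAG (cycleGraph (p * d + (d + 4))) →* RAAG (cycleGraph (d + 4)),
      Function.Injective F ∧
      IsQIEWith (wordDist (raagGen (cycleGraph (p * d + (d + 4)))))
        (wordDist (raagGen (cycleGraph (d + 4)))) (fun g => F g) := by
  set m := p * d + (d + 4) with hm
  obtain ⟨F, hF⟩ := exists_embedding (p := p) hd
  obtain ⟨Ψ, hΨ⟩ := exists_action (p := p) (gen m) hd (a := gen m (m - 1)) (commute_gen_succ m)
    (commute_gen_last (by omega)) (commute_gen_succ m (p * d + (d + 2))).symm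
  have hgen : ∀ k < m, ∀ r, Ψ (F (gen m k)) (r, 0) = (gen m k * r, 0) := by
    intro k hk r
    rw [hF k hk]
    rcases Nat.lt_or_ge (p * d + (d + 2)) k with h | h
    · obtain rfl : k = m - 1 := by omega
      rw [imageGen, if_neg (by omega), hΨ _ (by omega), stepPerm_apex]
      exact if_pos (Nat.zero_le _)
    · exact imageGen_apply hd hΨ h r
  have hact : ∀ g r, Ψ (F g) (r, 0) = (g * r, 0) := by
    intro g
    have hg : g ∈ Subgroup.closure (raagGen (cycleGraph m)) :=
      closure_raagGen (cycleGraph m) ▸ Subgroup.mem_top g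
    induction hg using Subgroup.closure_induction with
    | mem x hx =>
      obtain ⟨k, hk, rfl⟩ := exists_eq_gen (by omega) hx
      exact hgen k hk
    | one => simp
    | mul x y _ _ hx hy => simp [hx, hy, mul_assoc]
    | inv x _ hx =>
      intro r
      rw [map_inv, map_inv, Equiv.Perm.inv_eq_iff_eq, hx, mul_inv_cancel_left]
  have hlower : ∀ g, wordLength (raagGen (cycleGraph m)) g ≤
      wordLength (raagGen (cycleGraph (d + 4))) (F g) := by
    intro g
    have hT := closure_raagGen (cycleGraph m)
    have := wordLength_orbit_le (T := raagGen (cycleGraph m)) (closure_raagGen _) Ψ 0 ?_ ?_ (F g)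
    · simpa [hact] using this
    all_goals
      intro x hx y
      obtain ⟨i, hi, rfl⟩ := exists_eq_gen (by omega) hx
      rw [hΨ i hi]
      rcases Nat.lt_or_ge (d + 2) i with h | h
      · obtain rfl : i = d + 3 := by omega
        simp only [stepPerm_apex, stepPerm_apex_inv]
        exact wordLength_apexStep_le hT (by simp [gen_mem]) y
      · simp only [stepPerm_path _ _ h, stepPerm_path_inv _ _ h]
        exact wordLength_pathStep_le _ hT (by simp [gen_mem]) i y
  have : NeZero m := ⟨by omega⟩
  obtain ⟨K, hK⟩ := (Set.finite_range fun v : ZMod m =>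
    wordLength (raagGen (cycleGraph (d + 4))) (F (PresentedGroup.of v))).bddAbove
  have hupper := wordLength_map_le (closure_raagGen (cycleGraph m))
    (closure_raagGen (cycleGraph (d + 4))) F (K := K) (by
      rintro _ ⟨v, rfl⟩
      exact hK ⟨v, rfl⟩)
  refine ⟨F, fun g h hgh => ?_, K + 1, 0, by simp, le_rfl, fun x y => ?_⟩
  · have hg := hact g 1
    rw [hgh, hact] at hg
    simpa using (congrArg Prod.fst hg).symm
  · have hl : (wordLength (raagGen (cycleGraph m)) (x⁻¹ * y) : ℝ) ≤
        wordLength (raagGen (cycleGraph (d + 4))) (F (x⁻¹ * y)) := by exact_mod_cast hlower _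
    have hu : (wordLength (raagGen (cycleGraph (d + 4))) (F (x⁻¹ * y)) : ℝ) ≤
        K * wordLength (raagGen (cycleGraph m)) (x⁻¹ * y) := by exact_mod_cast hupper _
    simp only [wordDist, ← map_inv, ← map_mul]
    have h0 : (0 : ℝ) ≤ wordLength (raagGen (cycleGraph m)) (x⁻¹ * y) := Nat.cast_nonneg _
    constructor
    · have h1 : 1 / ((K : ℝ) + 1) ≤ 1 := by
        rw [div_le_one (by positivity)]
        simp
      have := mul_le_mul_of_nonneg_right h1 h0
      linarith
    · linarith

end Embedding

end RAAGCycle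

/-- For `n > 6` and `m = n + p(n-4)` with `p ≥ 1`, there is an injective
homomorphism `A_{C_m} → A_{C_n}` that is a quasiisometric embedding. -/
theorem injective_hom_qie (n p m : ℕ) (hn : 6 < n) (hp : 1 ≤ p)
    (hm : m = n + p * (n - 4)) :
    ∃ F : RAAG (cycleGraph m) →* RAAG (cycleGraph n),
      Function.Injective F ∧
      IsQIEWith (wordDist (raagGen (cycleGraph m))) (wordDist (raagGen (cycleGraph n)))
        (fun g => F g) := by
  obtain ⟨d, rfl⟩ : ∃ d, n = d + 4 := ⟨n - 4, by omega⟩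
  obtain rfl : m = p * d + (d + 4) := by
    rw [hm, Nat.add_sub_cancel, Nat.add_comm]
  exact RAAGCycle.exists_injective_hom_qie (by omega)
end
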